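/- Let c be a real number with 0 < c ≤ 1, let K = 75·10^4/c^5, and let G be a simple graph on n vertices with n ≥ 18K/c² and minimum degree at least c·n. Then for every even integer t with 4 ≤ t ≤ ec(G) − K, the graph G contains a cycle of length t, where ec(G) denotes the length of a longest even cycle in G (the conclusion is read as vacuous if G contains no even cycle). -/

import Mathlib

/-- `G` contains a cycle of length `m`. -/
def HasCycleLen {V : Type*} (G : SimpleGraph V) (m : ℕ) : Prop :=
  ∃ (v : V) (c : G.Walk v v), c.IsCycle ∧ c.length = m

namespace EC

section lists
variable {V : Type*}

def edg : List V → List (Sym2 V)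
  | a :: b :: t => s(a, b) :: edg (b :: t)
  | _ => []

def CE (l : List V) : List (Sym2 V) := edg (l ++ l.head?.toList)

theorem edg_append (l₁ : List V) (a : V) (l₂ : List V) :
    edg (l₁ ++ a :: l₂) = edg (l₁ ++ [a]) ++ edg (a :: l₂) := by
  induction l₁ with
  | nil => simp [edg]
  | cons b t ih =>
    cases t with
    | nil => simp [edg]
    | cons c t => simpa [edg] using ih

theorem edg_append2 (l₁ : List V) (a b : V) (l₂ : List V) :
    edg (l₁ ++ a :: b :: l₂) = edg (l₁ ++ [a]) ++ s(a, b) :: edg (b :: l₂) := by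
  rw [edg_append]; simp [edg]

theorem mem_edg_reverse (l : List V) (e : Sym2 V) : e ∈ edg l.reverse ↔ e ∈ edg l := by
  induction l with
  | nil => simp
  | cons a t ih =>
    cases t with
    | nil => simp
    | cons b t =>
      have : (a :: b :: t).reverse = t.reverse ++ b :: [a] := by simp
      rw [this, edg_append]
      simp only [List.mem_append]
      have h2 : (b :: t).reverse = t.reverse ++ [b] := by simp
      rw [← h2, ih]
      simp only [edg, List.mem_cons, List.not_mem_nil, or_false]
      rw [Sym2.eq_swap]; tauto

theorem mem_of_mem_edg (l : List V) (e : Sym2 V) (h : e ∈ edg l) (x : V) (hx : x ∈ e) :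
    x ∈ l := by
  induction l with
  | nil => simp [edg] at h
  | cons a t ih =>
    cases t with
    | nil => simp [edg] at h
    | cons b t =>
      simp only [edg, List.mem_cons] at h
      rcases h with rfl | h
      · simp at hx; rcases hx with rfl | rfl <;> simp
      · exact List.mem_cons_of_mem _ (ih h)

theorem CE_cons (a : V) (l : List V) : CE (a :: l) = edg (a :: (l ++ [a])) := by
  simp [CE]

theorem mem_of_mem_CE (l : List V) (e : Sym2 V) (h : e ∈ CE l) (x : V) (hx : x ∈ e) :
    x ∈ l := by
  have := mem_of_mem_edg _ e h x hx
  cases l with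
  | nil => simp at this
  | cons a t => simp at this ⊢; tauto

theorem mem_CE_rot (A B : List V) (e : Sym2 V) : e ∈ CE (A ++ B) ↔ e ∈ CE (B ++ A) := by
  cases A with
  | nil => simp
  | cons a A =>
    cases B with
    | nil => simp
    | cons b B =>
      simp only [List.cons_append, CE_cons]
      have h1 : a :: (A ++ b :: B ++ [a]) = (a :: A) ++ b :: (B ++ [a]) := by simp
      have h2 : b :: (B ++ a :: A ++ [b]) = (b :: B) ++ a :: (A ++ [b]) := by simp
      rw [h1, h2, edg_append, edg_append (b :: B)]
      simp only [List.mem_append, List.cons_append]; tauto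

theorem mem_CE_form (v : V) (mid : List V) (u : V) (e : Sym2 V) :
    e ∈ CE (v :: (mid ++ [u])) ↔ e ∈ edg (v :: (mid ++ [u])) ∨ e = s(u, v) := by
  rw [CE_cons]
  have h1 : v :: (mid ++ [u] ++ [v]) = (v :: mid) ++ u :: [v] := by simp
  rw [h1, edg_append]
  simp [edg]

/-- from an infix split of an edge -/
theorem split_of_mem_edg (l : List V) (e : Sym2 V) (h : e ∈ edg l) :
    ∃ X a b Y, l = X ++ a :: b :: Y ∧ e = s(a, b) := by
  induction l with
  | nil => simp [edg] at h
  | cons a t ih =>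
    cases t with
    | nil => simp [edg] at h
    | cons b t =>
      simp only [edg, List.mem_cons] at h
      rcases h with rfl | h
      · exact ⟨[], a, b, t, rfl, rfl⟩
      · obtain ⟨X, x, y, Y, h1, h2⟩ := ih h
        exact ⟨a :: X, x, y, Y, by rw [h1]; rfl, h2⟩

theorem nf_aux (l : List V) (e : Sym2 V) (h : e ∈ CE l) (hd : ¬ e.IsDiag) :
    ∃ a b mid, e = s(a, b) ∧ l.Perm (b :: (mid ++ [a])) ∧
      ∀ f, f ∈ CE (b :: (mid ++ [a])) ↔ f ∈ CE l := by
  cases l with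
  | nil => simp [CE, edg] at h
  | cons c t =>
    rw [CE_cons] at h
    obtain ⟨X, a, b, Y, h1, rfl⟩ := split_of_mem_edg _ _ h
    rcases List.eq_nil_or_concat Y with rfl | ⟨Y', y, rfl⟩
    · -- closing edge
      have h2 : c :: t ++ [c] = (X ++ [a]) ++ [b] := by simpa using h1
      have h3 := List.append_inj' h2 rfl
      obtain ⟨h3, h4⟩ := h3
      have h4 : c = b := by simpa using h4
      subst h4
      cases X with
      | nil => simp at h3; simp [h3.1] at hd
      | cons x X =>
        simp at h3
        obtain ⟨rfl, rfl⟩ := h3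
        exact ⟨a, c, X, rfl, List.Perm.refl _, fun f => Iff.rfl⟩
    · have h2 : c :: t ++ [c] = (X ++ a :: b :: Y') ++ [y] := by simpa using h1
      have h3 := (List.append_inj' h2 rfl).1
      refine ⟨a, b, Y' ++ X, rfl, ?_, ?_⟩
      · rw [h3]
        have : X ++ a :: b :: Y' = (X ++ [a]) ++ (b :: Y') := by simp
        rw [this]
        refine List.perm_append_comm.trans ?_
        simp
      · intro f
        rw [h3]
        have e1 : X ++ a :: b :: Y' = (X ++ [a]) ++ (b :: Y') := by simp
        have e2 : b :: (Y' ++ X ++ [a]) = (b :: Y') ++ (X ++ [a]) := by simp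
        rw [e1, e2]
        exact mem_CE_rot _ _ _

theorem normal_form (l : List V) (u v : V) (huv : u ≠ v) (h : s(u, v) ∈ CE l) :
    ∃ mid, l.Perm (v :: (mid ++ [u])) ∧
      ∀ f, f ∈ CE (v :: (mid ++ [u])) ↔ f ∈ CE l := by
  obtain ⟨a, b, mid, h1, h2, h3⟩ := nf_aux l _ h (by simpa using huv)
  rcases Sym2.eq_iff.1 h1 with ⟨rfl, rfl⟩ | ⟨rfl, rfl⟩
  · exact ⟨mid, h2, h3⟩
  · refine ⟨mid.reverse, h2.trans ?_, ?_⟩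
    · have : v :: (mid.reverse ++ [u]) = (u :: (mid ++ [v])).reverse := by simp
      rw [this]; exact (List.reverse_perm _).symm
    · intro f
      rw [← h3 f, mem_CE_form, mem_CE_form]
      have : v :: (mid.reverse ++ [u]) = (u :: (mid ++ [v])).reverse := by simp
      rw [this, mem_edg_reverse]
      rw [Sym2.eq_swap (a := u)]

end lists

structure St {V : Type*} (G : SimpleGraph V) (l : List V) (E : List (Sym2 V)) (R : Finset V) :
    Prop where
  nd : l.Nodup
  end_ : E.Nodup
  sub : ∀ e ∈ E, e ∈ CE l
  adj : ∀ e ∈ CE l, e ∈ E ∨ e ∈ G.edgeSet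
  par : Even (l.length + E.length)
  off : ∀ x ∈ l, x ∉ R
  len : 3 ≤ l.length

section ops
variable {V : Type*} {G : SimpleGraph V}

theorem St.congr {l l' : List V} {E R} (h : St G l E R) (hp : l.Perm l')
    (hc : ∀ f, f ∈ CE l' ↔ f ∈ CE l) : St G l' E R where
  nd := hp.nodup_iff.1 h.nd
  end_ := h.end_
  sub e he := (hc e).2 (h.sub e he)
  adj e he := h.adj e ((hc e).1 he)
  par := by rw [← hp.length_eq]; exact h.par
  off x hx := h.off x (hp.mem_iff.2 hx)
  len := by rw [← hp.length_eq]; exact h.len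

theorem edg_subset_CE (l : List V) (e : Sym2 V) (h : e ∈ edg l) : e ∈ CE l := by
  cases l with
  | nil => simp [edg] at h
  | cons a t =>
    rcases List.eq_nil_or_concat t with rfl | ⟨t', y, rfl⟩
    · simp [edg] at h
    · have := (mem_CE_form a t' y e).2
      simp at h this ⊢
      exact this (Or.inl h)

theorem not_mem_inner (mid : List V) (u v : V) (huv : u ≠ v)
    (hnd : (v :: (mid ++ [u])).Nodup) (hl : 1 ≤ mid.length) :
    s(u, v) ∉ edg (v :: (mid ++ [u])) := by
  intro he
  obtain ⟨X, a, b, Y, h5, h6⟩ := split_of_mem_edg _ _ he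
  have hmid : mid = [] := by
    cases X with
    | nil =>
      simp only [List.nil_append, List.cons.injEq] at h5
      obtain ⟨rfl, h5⟩ := h5
      rcases Sym2.eq_iff.1 h6 with ⟨h7, h8⟩ | ⟨h7, h8⟩
      · exact absurd h7 huv
      · subst h7
        cases mid with
        | nil => rfl
        | cons c mid =>
          simp at h5
          obtain ⟨rfl, h5⟩ := h5
          simp at hnd
    | cons x X =>
      simp only [List.cons_append, List.cons.injEq] at h5
      obtain ⟨rfl, h5⟩ := h5
      exfalso
      have : v ∈ mid ++ [u] := by
        rw [h5]
        rcases Sym2.eq_iff.1 h6 with ⟨h7, h8⟩ | ⟨h7, h8⟩ <;> subst h7 <;> subst h8 <;> simp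
      exact (List.nodup_cons.1 hnd).1 this
  subst hmid
  simp at hl

/-- Replace the virtual edge `s(u,v)` by a path `u p v` off the cycle. -/
theorem St.expand {l : List V} {E : List (Sym2 V)} {R R' : Finset V} {u v : V} {p : List V}
    (h : St G l (s(u, v) :: E) R) (huv : u ≠ v) (hp : p.Nodup) (hodd : Odd p.length)
    (hoff : ∀ x ∈ p, x ∉ l) (hadj : ∀ e ∈ edg (u :: (p ++ [v])), e ∈ G.edgeSet)
    (hR : ∀ x ∈ p, x ∉ R') (hRR : R' ⊆ R) :
    ∃ l', St G l' E R' ∧ l'.length = l.length + p.length ∧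
      (∀ x, x ∈ l' ↔ x ∈ l ∨ x ∈ p) := by
  obtain ⟨mid, h1, h2⟩ := normal_form l u v huv (h.sub _ (by simp))
  have h' := h.congr h1 h2
  have key : ∀ e, e ∈ CE (v :: (mid ++ [u]) ++ p) ↔
      e ∈ edg (v :: (mid ++ [u])) ∨ e ∈ edg (u :: (p ++ [v])) := by
    intro e
    have e1 : v :: (mid ++ [u]) ++ p = v :: (mid ++ u :: p) := by simp
    rw [e1, CE_cons]
    have e2 : v :: (mid ++ u :: p ++ [v]) = (v :: mid) ++ u :: (p ++ [v]) := by simp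
    rw [e2, edg_append]; simp
  refine ⟨v :: (mid ++ [u]) ++ p, ⟨?_, ?_, ?_, ?_, ?_, ?_, ?_⟩, ?_, ?_⟩
  · rw [List.nodup_append]
    refine ⟨h'.nd, hp, ?_⟩
    intro a ha b hb hab
    subst hab
    exact hoff _ hb (h1.mem_iff.2 ha)
  · exact h.end_.of_cons
  · intro e he
    rw [key]
    left
    have := (mem_CE_form v mid u e).1 (h'.sub e (by simp [he]))
    rcases this with h3 | h3
    · exact h3
    · subst h3
      have := h.end_
      simp [he] at this
  · intro e he
    rw [key] at he
    rcases he with he | he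
    · have h4 := h'.adj e ((mem_CE_form v mid u e).2 (Or.inl he))
      simp only [List.mem_cons] at h4
      rcases h4 with (h4 | h4) | h4
      · subst h4
        exact absurd he (not_mem_inner mid u v huv h'.nd (by simpa using h'.len))
      · exact Or.inl h4
      · exact Or.inr h4
    · exact Or.inr (hadj e he)
  · have := h.par
    rw [h1.length_eq] at this
    simp only [List.length_cons, List.length_append] at this ⊢
    obtain ⟨k, hk⟩ := hodd
    obtain ⟨j, hj⟩ := this
    exact ⟨k + j, by simp at hj ⊢; omega⟩
  · intro x hx
    rw [List.mem_append] at hx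
    rcases hx with hx | hx
    · exact fun hh => h'.off x hx (hRR hh)
    · exact hR x hx
  · have := h'.len
    simp at this ⊢; omega
  · rw [h1.length_eq]; simp; omega
  · intro x
    rw [h1.mem_iff, List.mem_append]

/-- Delete the interior of a segment, making its ends a virtual edge. -/
theorem St.addPending {A int B : List V} {E : List (Sym2 V)} {R : Finset V} {u v : V}
    (h : St G (A ++ u :: (int ++ v :: B)) E R) (hodd : Odd int.length)
    (hav : ∀ f ∈ E, ∀ x ∈ f, x ∉ u :: (int ++ [v]))
    (hlen : 3 ≤ (A ++ u :: v :: B).length) :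
    St G (A ++ u :: v :: B) (s(u, v) :: E) R := by
  have key1 : ∀ e, e ∈ CE (A ++ u :: (int ++ v :: B)) ↔
      e ∈ edg (u :: (int ++ [v])) ∨ e ∈ edg (v :: (B ++ A ++ [u])) := by
    intro e
    rw [mem_CE_rot]
    have e1 : u :: (int ++ v :: B) ++ A = u :: (int ++ v :: (B ++ A)) := by simp
    rw [e1, CE_cons]
    have e2 : u :: (int ++ v :: (B ++ A) ++ [u]) = (u :: int) ++ v :: (B ++ A ++ [u]) := by simp
    rw [e2, edg_append]; simp
  have key2 : ∀ e, e ∈ CE (A ++ u :: v :: B) ↔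
      e = s(u, v) ∨ e ∈ edg (v :: (B ++ A ++ [u])) := by
    intro e
    rw [mem_CE_rot]
    have e1 : u :: v :: B ++ A = u :: (v :: (B ++ A)) := by simp
    rw [e1, CE_cons]
    simp [edg]
  refine ⟨?_, ?_, ?_, ?_, ?_, ?_, hlen⟩
  · refine h.nd.sublist ?_
    refine (List.Sublist.refl A).append ?_
    refine List.Sublist.cons_cons _ ?_
    exact List.sublist_append_right _ _
  · rw [List.nodup_cons]
    refine ⟨fun he => ?_, h.end_⟩
    exact hav _ he u (by simp) (by simp)
  · intro e he
    rw [key2]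
    rw [List.mem_cons] at he
    rcases he with rfl | he
    · exact Or.inl rfl
    · right
      rcases (key1 e).1 (h.sub e he) with h3 | h3
      · exfalso
        induction e using Sym2.ind with
        | _ x y =>
          exact hav _ he x (by simp) (mem_of_mem_edg _ _ h3 x (by simp))
      · exact h3
  · intro e he
    rcases (key2 e).1 he with rfl | he
    · simp
    · rcases h.adj e ((key1 e).2 (Or.inr he)) with h3 | h3
      · simp [h3]
      · simp [h3]
  · obtain ⟨k, hk⟩ := hodd
    obtain ⟨j, hj⟩ := h.par
    simp at hj ⊢
    exact ⟨j - k, by omega⟩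
  · intro x hx
    apply h.off x
    simp at hx ⊢
    tauto

/-- Resolve a virtual edge by two crossing chords. -/
theorem St.cross {A' J B' mid : List V} {E : List (Sym2 V)} {R : Finset V} {u v z z' : V}
    (h : St G (v :: (mid ++ [u])) (s(u, v) :: E) R) (huv : u ≠ v)
    (hs : v :: (mid ++ [u]) = A' ++ z :: (J ++ z' :: B'))
    (hz : G.Adj u z) (hz' : G.Adj v z') (hvz : v ≠ z) (hodd : Odd J.length)
    (hav : ∀ f ∈ E, ∀ x ∈ f, x ∉ J)
    (hlen : 3 ≤ (A' ++ z :: (z' :: B').reverse).length) :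
    St G (A' ++ z :: (z' :: B').reverse) E R := by
  have hJ : J ≠ [] := by rintro rfl; simp at hodd
  -- A' starts with v, B' ends with u
  obtain ⟨A'', rfl⟩ : ∃ A'', A' = v :: A'' := by
    cases A' with
    | nil => simp at hs; exact absurd hs.1 hvz
    | cons a A'' => simp at hs; exact ⟨A'', by rw [hs.1]⟩
  obtain ⟨B'', hB⟩ : ∃ B'', z' :: B' = B'' ++ [u] := by
    rcases List.eq_nil_or_concat (z' :: B') with h0 | ⟨B'', y, h0⟩
    · simp at h0
    · rw [h0] at hs
      refine ⟨B'', ?_⟩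
      have h2 : v :: mid ++ [u] = (v :: A'' ++ z :: (J ++ B'')) ++ [y] := by simpa using hs
      have h3 := (List.append_inj' h2 rfl).2
      simp at h3; rw [h0, h3]; simp
  have hrev : (z' :: B').reverse = u :: B''.reverse := by rw [hB]; simp
  have hrev' : u :: B''.reverse = B'.reverse ++ [z'] := by rw [← hrev]; simp
  have key1 : ∀ e, e ∈ edg (v :: (mid ++ [u])) ↔
      e ∈ edg (v :: (A'' ++ [z])) ∨ e ∈ edg (z :: (J ++ [z'])) ∨ e ∈ edg (z' :: B') := by
    intro e
    rw [hs, edg_append]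
    have : z :: (J ++ z' :: B') = (z :: J) ++ z' :: B' := by simp
    rw [this, edg_append (z :: J)]; simp
  have key2 : ∀ e, e ∈ CE (v :: A'' ++ z :: (z' :: B').reverse) ↔
      e ∈ edg (v :: (A'' ++ [z])) ∨ e = s(z, u) ∨ e ∈ edg (z' :: B') ∨ e = s(z', v) := by
    intro e
    have e1 : v :: A'' ++ z :: (z' :: B').reverse = v :: (A'' ++ z :: (z' :: B').reverse) := by simp
    rw [e1, CE_cons]
    have e2 : v :: (A'' ++ z :: (z' :: B').reverse ++ [v]) =
      (v :: A'') ++ z :: u :: (B''.reverse ++ [v]) := by rw [hrev]; simp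
    rw [e2, edg_append2]
    have e3 : u :: (B''.reverse ++ [v]) = B'.reverse ++ z' :: [v] := by
      have : u :: (B''.reverse ++ [v]) = u :: B''.reverse ++ [v] := by simp
      rw [this, hrev']; simp
    rw [e3, edg_append B'.reverse]
    have e4 : B'.reverse ++ [z'] = (z' :: B').reverse := by simp
    rw [e4]
    simp only [List.mem_append, List.mem_cons, mem_edg_reverse, edg, List.cons_append,
      List.not_mem_nil, or_false]
  have hnd := h.nd
  rw [hs] at hnd
  have hninner := not_mem_inner mid u v huv h.nd (by simpa using h.len)
  refine ⟨?_, h.end_.of_cons, ?_, ?_, ?_, ?_, hlen⟩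
  · have hsub : (v :: A'' ++ z :: (z' :: B')).Nodup := by
      refine hnd.sublist ?_
      refine (List.Sublist.refl _).append ?_
      refine List.Sublist.cons_cons _ ?_
      exact List.sublist_append_right _ _
    refine (List.Perm.nodup_iff ?_).1 hsub
    refine List.Perm.append_left _ ?_
    refine List.Perm.cons _ ?_
    exact (List.reverse_perm _).symm
  · intro e he
    rw [key2]
    have he1 := (mem_CE_form v mid u e).1 (h.sub e (by simp [he]))
    rcases he1 with h3 | h3
    · rcases (key1 e).1 h3 with h4 | h4 | h4
      · exact Or.inl h4
      · exfalso
        obtain ⟨j, J', rfl⟩ := List.exists_cons_of_ne_nil hJ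
        obtain ⟨X, a, b, Y, h5, rfl⟩ := split_of_mem_edg _ _ h4
        have ha : a ∉ j :: J' := hav _ he a (by simp)
        have hb : b ∉ j :: J' := hav _ he b (by simp)
        cases X with
        | nil => simp at h5; simp [← h5.2.1] at hb
        | cons x X =>
          simp only [List.cons_append, List.cons.injEq] at h5
          have h6 := h5.2
          rcases List.eq_nil_or_concat Y with rfl | ⟨Y', y, rfl⟩
          · have h2 : j :: J' ++ [z'] = (X ++ [a]) ++ [b] := by simpa using h6
            have h3 := (List.append_inj' h2 rfl).1
            rw [h3] at ha; simp at ha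
          · have h2 : j :: J' ++ [z'] = (X ++ a :: b :: Y') ++ [y] := by simpa using h6
            have h3 := (List.append_inj' h2 rfl).1
            rw [h3] at ha; simp at ha
      · tauto
    · subst h3
      have := h.end_
      simp [he] at this
  · intro e he
    have aux : e ∈ edg (v :: (mid ++ [u])) → e ∈ E ∨ e ∈ G.edgeSet := by
      intro h3
      have h4 := h.adj e ((mem_CE_form v mid u e).2 (Or.inl h3))
      simp only [List.mem_cons] at h4
      rcases h4 with (h4 | h4) | h4
      · subst h4; exact absurd h3 hninner
      · exact Or.inl h4
      · exact Or.inr h4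
    rcases (key2 e).1 he with h3 | rfl | h3 | rfl
    · exact aux ((key1 e).2 (Or.inl h3))
    · right; simpa using hz.symm
    · exact aux ((key1 e).2 (Or.inr (Or.inr h3)))
    · right; simpa using hz'.symm
  · obtain ⟨k, hk⟩ := hodd
    have h3 := h.par
    rw [hs] at h3
    obtain ⟨j, hj⟩ := h3
    simp at hj ⊢
    exact ⟨j - k - 1, by omega⟩
  · intro x hx
    apply h.off x
    rw [hs]
    simp at hx ⊢
    tauto

end ops
end EC
set_option linter.unusedSectionVars false
namespace EC
section counting
open Finset

theorem pigeon (I : Finset ℕ) (n D r : ℕ) (B : Finset ℕ) (hI : ∀ i ∈ I, i < n) (hD : 0 < D)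
    (h : B.card * D + r * (2 * (n / D + 1)) < I.card) :
    ∃ β, β ∉ B ∧ ∃ I0 ⊆ I, r < I0.card ∧ (∀ i ∈ I0, i / D = β) ∧
      ∀ i ∈ I0, ∀ j ∈ I0, i % 2 = j % 2 := by
  have h1 : (I.filter (fun i => i / D ∈ B)).card ≤ B.card * D := by
    have : I.filter (fun i => i / D ∈ B) ⊆ B.biUnion (fun b => Ico (b * D) (b * D + D)) := by
      intro i hi
      rw [mem_filter] at hi
      rw [mem_biUnion]
      refine ⟨i / D, hi.2, ?_⟩
      rw [mem_Ico]
      have := Nat.div_add_mod i D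
      have := Nat.mod_lt i hD
      rw [mul_comm]; omega
    refine (card_le_card this).trans ?_
    refine card_biUnion_le_card_mul _ _ _ ?_
    intro b _; simp
  have h2 := card_filter_add_card_filter_not (s := I) (fun i => i / D ∈ B)
  have hmap : ∀ i ∈ I.filter (fun i => ¬ i / D ∈ B),
      (i / D, i % 2) ∈ (range (n / D + 1)) ×ˢ (range 2) := by
    intro i hi
    rw [mem_filter] at hi
    rw [mem_product, mem_range, mem_range]
    have := Nat.div_le_div_right (c := D) (hI i hi.1).le
    exact ⟨by simp; omega, by simp; omega⟩
  obtain ⟨y, hy, hy2⟩ := exists_lt_card_fiber_of_mul_lt_card_of_maps_to (n := r) hmap (by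
    rw [card_product, card_range, card_range]
    have : (n / D + 1) * 2 * r = r * (2 * (n / D + 1)) := by ring
    omega)
  refine ⟨y.1, ?_, _, ?_, hy2, ?_, ?_⟩
  · obtain ⟨i, hi⟩ := card_pos.1 (lt_of_le_of_lt (Nat.zero_le _) hy2)
    rw [mem_filter, mem_filter] at hi
    rw [← hi.2]
    exact hi.1.2
  · exact (filter_subset _ _).trans (filter_subset _ _)
  · intro i hi
    rw [mem_filter] at hi
    rw [← hi.2]
  · intro i hi j hj
    rw [mem_filter] at hi hj
    have h1 : i % 2 = y.2 := by rw [← hi.2]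
    have h2 : j % 2 = y.2 := by rw [← hj.2]
    rw [h1, h2]

theorem split_at {V : Type*} (l : List V) (i j : ℕ) (u v : V) (hi : l[i]? = some u)
    (hj : l[j]? = some v) (hij : i < j) :
    ∃ A int B, l = A ++ u :: (int ++ v :: B) ∧ A.length = i ∧ int.length = j - i - 1 ∧
      (∀ x ∈ int, ∃ k, i < k ∧ k < j ∧ l[k]? = some x) := by
  have hil : i < l.length := by
    rw [List.getElem?_eq_some_iff] at hi; exact hi.1
  have hjl : j < l.length := by
    rw [List.getElem?_eq_some_iff] at hj; exact hj.1
  have e1 : l = l.take i ++ u :: l.drop (i + 1) := by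
    conv_lhs => rw [← List.take_append_drop i l]
    rw [List.drop_eq_getElem_cons hil]
    rw [List.getElem?_eq_getElem hil] at hi
    simp only [Option.some.injEq] at hi
    rw [hi]
  have hj' : (l.drop (i + 1))[j - i - 1]? = some v := by
    rw [List.getElem?_drop]
    rw [← hj]; congr 1; omega
  have e2 : l.drop (i + 1) = (l.drop (i + 1)).take (j - i - 1) ++ v :: l.drop (j + 1) := by
    conv_lhs => rw [← List.take_append_drop (j - i - 1) (l.drop (i + 1))]
    have h3 : j - i - 1 < (l.drop (i + 1)).length := by simp; omega
    rw [List.drop_eq_getElem_cons h3]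
    rw [List.getElem?_eq_getElem h3] at hj'
    simp only [Option.some.injEq] at hj'
    rw [hj', List.drop_drop]
    congr 3; omega
  refine ⟨l.take i, (l.drop (i + 1)).take (j - i - 1), l.drop (j + 1), ?_, ?_, ?_, ?_⟩
  · rw [← e2]; exact e1
  · simp; omega
  · simp; omega
  · intro x hx
    rw [List.mem_iff_getElem?] at hx
    obtain ⟨k, hk⟩ := hx
    rw [List.getElem?_take] at hk
    split_ifs at hk with hk2
    rw [List.getElem?_drop] at hk
    exact ⟨i + 1 + k, by omega, by omega, hk⟩

end counting

section ops2
open Finset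
variable {V : Type*} [Fintype V] [DecidableEq V] {G : SimpleGraph V}

open Classical in
noncomputable def cmn (G : SimpleGraph V) (u v : V) : Finset V :=
  univ.filter (fun z => G.Adj u z ∧ G.Adj v z)

theorem mem_cmn {u v z : V} : z ∈ cmn G u v ↔ G.Adj u z ∧ G.Adj v z := by
  simp [cmn]

theorem exists_verts (E : List (Sym2 V)) :
    ∃ Q : Finset V, Q.card ≤ 2 * E.length ∧ ∀ f ∈ E, ∀ x ∈ f, x ∈ Q := by
  induction E with
  | nil => exact ⟨∅, by simp, by simp⟩
  | cons e E ih =>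
    obtain ⟨Q, h1, h2⟩ := ih
    induction e using Sym2.ind with
    | _ a b =>
      refine ⟨insert a (insert b Q), ?_, ?_⟩
      · have := card_insert_le a (insert b Q)
        have := card_insert_le b Q
        simp; omega
      · intro f hf x hx
        rw [List.mem_cons] at hf
        rcases hf with rfl | hf
        · simp at hx; simp; tauto
        · simp [h2 f hf x hx]

theorem idx_eq {l : List V} (hl : l.Nodup) {k : ℕ} {x : V} (h : l[k]? = some x) :
    l.idxOf x = k := by
  rw [List.getElem?_eq_some_iff] at h
  obtain ⟨hk, rfl⟩ := h
  exact hl.idxOf_getElem k hk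

theorem get_idx {l : List V} {x : V} (h : x ∈ l) : l[l.idxOf x]? = some x :=
  List.getElem?_idxOf h

theorem nodup_len {l : List V} (hl : l.Nodup) : l.length ≤ Fintype.card V := hl.length_le_card

theorem idx_image_card {l : List V} (A : Finset V) (hA : ∀ x ∈ A, x ∈ l) :
    (A.image (fun x => l.idxOf x)).card = A.card := by
  refine card_image_of_injOn ?_
  intro x hx y hy hxy
  have h1 := get_idx (hA x hx)
  have h2 := get_idx (hA y hy)
  simp only at hxy
  rw [hxy, h2] at h1
  simpa using h1.symm

theorem St.resolve {l : List V} {E : List (Sym2 V)} {R : Finset V} {u v : V} {a De : ℕ}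
    (h : St G l (s(u, v) :: E) R) (huv : u ≠ v) (ha : a ≤ (cmn G u v).card) (hDe : 0 < De)
    (hnum : R.card + 2 * E.length * De + 2 * (Fintype.card V / De + 1) < a)
    (hlen : De + 3 ≤ l.length) :
    ∃ l', St G l' E R ∧ l'.length ≤ l.length + 1 ∧ l.length ≤ l'.length + De := by
  by_cases hz : ∃ z ∈ cmn G u v, z ∉ R ∧ z ∉ l
  · obtain ⟨z, hz1, hz2, hz3⟩ := hz
    rw [mem_cmn] at hz1
    obtain ⟨l', h1, h2, h3⟩ := h.expand (p := [z]) (R' := R) huv (by simp) (by simp)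
      (by simpa using hz3) (by
        intro e he
        simp [edg] at he
        rcases he with rfl | rfl
        · simpa using hz1.1
        · simpa using hz1.2.symm) (by simpa using hz2) subset_rfl
    refine ⟨l', h1, ?_, ?_⟩ <;> simp at h2 <;> omega
  · push Not at hz
    obtain ⟨mid, hp, hc⟩ := normal_form l u v huv (h.sub _ (by simp))
    have h' := h.congr hp hc
    obtain ⟨Q, hQ1, hQ2⟩ := exists_verts E
    set l1 := v :: (mid ++ [u]) with hl1
    have hA : ∀ x ∈ cmn G u v \ R, x ∈ l1 := by
      intro x hx
      rw [mem_sdiff] at hx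
      exact hp.mem_iff.1 (hz x hx.1 hx.2)
    have hcard := idx_image_card _ hA
    have hAc : a - R.card ≤ (cmn G u v \ R).card := by
      have := le_card_sdiff R (cmn G u v)
      omega
    have hB : (Q.image (fun x => l1.idxOf x / De)).card ≤ 2 * E.length :=
      card_image_le.trans hQ1
    obtain ⟨β, hβ, I0, hI0, hI0c, hI0b, hI0p⟩ := pigeon
      ((cmn G u v \ R).image (fun x => l1.idxOf x)) (Fintype.card V) De 1
      (Q.image (fun x => l1.idxOf x / De)) (by
        intro i hi
        rw [mem_image] at hi
        obtain ⟨x, hx, rfl⟩ := hi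
        exact lt_of_lt_of_le (List.idxOf_lt_length_of_mem (hA x hx)) (nodup_len h'.nd)) hDe (by
        rw [hcard]
        have := Nat.mul_le_mul_right De hB
        omega)
    have hex : ∃ i ∈ I0, ∃ j ∈ I0, i < j := by
      obtain ⟨i, hi, j, hj, hij⟩ := one_lt_card.1 hI0c
      rcases Nat.lt_or_gt_of_ne hij with h1 | h1
      · exact ⟨i, hi, j, hj, h1⟩
      · exact ⟨j, hj, i, hi, h1⟩
    obtain ⟨i, hi, j, hj, hij⟩ := hex
    have hi1 := hI0 hi
    have hj1 := hI0 hj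
    rw [mem_image] at hi1 hj1
    obtain ⟨z, hz1, hz2⟩ := hi1
    obtain ⟨z', hz1', hz2'⟩ := hj1
    have hzi : l1[i]? = some z := by rw [← hz2]; exact get_idx (hA z hz1)
    have hzj : l1[j]? = some z' := by rw [← hz2']; exact get_idx (hA z' hz1')
    obtain ⟨A', J, B', hs, hA', hJ, hJx⟩ := split_at l1 i j z z' hzi hzj hij
    have hbi := hI0b i hi
    have hbj := hI0b j hj
    have hpar := hI0p i hi j hj
    have hz3 := (mem_cmn.1 (mem_sdiff.1 hz1).1)
    have hz3' := (mem_cmn.1 (mem_sdiff.1 hz1').1)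
    have hjiD : j < i + De := by
      have h1 := Nat.div_add_mod i De
      have h2 := Nat.div_add_mod j De
      have h3 := Nat.mod_lt j hDe
      rw [hbi] at h1; rw [hbj] at h2; omega
    have hlen1 := hp.length_eq
    have hlen2 := congrArg List.length hs
    simp only [List.length_append, List.length_cons] at hlen2
    have hfin : (A' ++ z :: (z' :: B').reverse).length + J.length = l.length := by
      rw [hlen1, hlen2]; simp; omega
    refine ⟨A' ++ z :: (z' :: B').reverse, ?_, ?_, ?_⟩
    · refine h'.cross huv hs hz3.1 hz3'.2 hz3.2.ne ?_ ?_ ?_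
      · rw [hJ, Nat.odd_iff]; omega
      · intro f hf x hx hxJ
        obtain ⟨k, hk1, hk2, hk3⟩ := hJx x hxJ
        apply hβ
        rw [mem_image]
        refine ⟨x, hQ2 f hf x hx, ?_⟩
        rw [idx_eq h'.nd hk3]
        have h1 := Nat.div_le_div_right (c := De) hk1.le
        have h2 := Nat.div_le_div_right (c := De) hk2.le
        omega
      · omega
    · omega
    · omega

/-- every `m`-set contains a good pair -/
def Hyp (G : SimpleGraph V) (m a : ℕ) : Prop :=
  ∀ T : Finset V, m ≤ T.card → ∃ u ∈ T, ∃ v ∈ T, u ≠ v ∧ a ≤ (cmn G u v).card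

theorem cmn_comm (u v : V) : cmn G u v = cmn G v u := by
  ext z; rw [mem_cmn, mem_cmn]; tauto

theorem findSeg {l : List V} {E : List (Sym2 V)} {m a : ℕ} (hl : l.Nodup)
    (H : Hyp G m a) (hm : 0 < m) (hlen : (2 * E.length + 1) * (4 * m) ≤ l.length) :
    ∃ A u int v B, l = A ++ u :: (int ++ v :: B) ∧ Odd int.length ∧ 3 ≤ int.length ∧
      int.length ≤ 4 * m ∧ (∀ f ∈ E, ∀ x ∈ f, x ∉ u :: (int ++ [v])) ∧ u ≠ v ∧
      a ≤ (cmn G u v).card := by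
  obtain ⟨Q, hQ1, hQ2⟩ := exists_verts E
  have : ∃ β ∈ range (2 * E.length + 1), β ∉ Q.image (fun x => l.idxOf x / (4 * m)) := by
    by_contra hcon
    push Not at hcon
    have h1 := card_le_card (show range (2 * E.length + 1) ⊆ _ from hcon)
    have h2 := card_image_le (s := Q) (f := fun x => l.idxOf x / (4 * m))
    simp at h1
    omega
  obtain ⟨β, hβ1, hβ2⟩ := this
  rw [mem_range] at hβ1
  have hbound : ∀ k < 4 * m, β * (4 * m) + k < l.length := by
    intro k hk
    have : (β + 1) * (4 * m) ≤ (2 * E.length + 1) * (4 * m) := Nat.mul_le_mul_right _ hβ1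
    have e : (β + 1) * (4 * m) = β * (4 * m) + 4 * m := by ring
    omega
  have hbd : ∀ k : Fin m, β * (4 * m) + 4 * k.1 < l.length := fun k => hbound _ (by omega)
  let g : Fin m → V := fun k => l[β * (4 * m) + 4 * k.1]'(hbd k)
  have hg : ∀ k, l[β * (4 * m) + 4 * k.1]? = some (g k) := fun k =>
    List.getElem?_eq_getElem (hbd k)
  have hginj : Function.Injective g := by
    intro k k' hkk
    have h1 := idx_eq hl (hg k)
    have h2 := idx_eq hl (hg k')
    rw [hkk, h2] at h1
    ext; omega
  have hex : ∃ k k' : Fin m, k < k' ∧ a ≤ (cmn G (g k) (g k')).card := by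
    obtain ⟨u, hu, v, hv, huv, h1⟩ := H (univ.image g) (by
      rw [card_image_of_injective _ hginj]; simp)
    rw [mem_image] at hu hv
    obtain ⟨k, -, rfl⟩ := hu
    obtain ⟨k', -, rfl⟩ := hv
    have hne : k ≠ k' := fun h => huv (by rw [h])
    rcases lt_or_gt_of_ne hne with h2 | h2
    · exact ⟨k, k', h2, h1⟩
    · exact ⟨k', k, h2, by rw [cmn_comm]; exact h1⟩
  obtain ⟨k, k', hkk, hgood⟩ := hex
  have hkk' : k.1 < k'.1 := hkk
  obtain ⟨A, int, B, hs, hA, hint, hx⟩ := split_at l _ _ _ _ (hg k) (hg k') (by omega)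
  refine ⟨A, g k, int, g k', B, hs, ?_, ?_, ?_, ?_, ?_, hgood⟩
  · rw [hint, Nat.odd_iff]; omega
  · omega
  · have := k'.2; omega
  · intro f hf x hxf hxm
    apply hβ2
    rw [mem_image]
    refine ⟨x, hQ2 f hf x hxf, ?_⟩
    have : ∃ q < 4 * m, l[β * (4 * m) + q]? = some x := by
      simp only [List.mem_cons, List.mem_append, List.not_mem_nil, or_false] at hxm
      have h2 := k'.2
      rcases hxm with rfl | hxm | rfl
      · exact ⟨4 * k.1, by omega, hg k⟩
      · obtain ⟨q, hq1, hq2, hq3⟩ := hx x hxm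
        refine ⟨q - β * (4 * m), by omega, ?_⟩
        rw [← hq3]; congr 1; omega
      · exact ⟨4 * k'.1, by omega, hg k'⟩
    obtain ⟨q, hq, hq2⟩ := this
    rw [idx_eq hl hq2]
    rw [mul_comm, Nat.mul_add_div (by omega), Nat.div_eq_of_lt hq]; simp
  · intro h
    have := hginj h
    omega

/-- `w` sits strictly inside a removable segment of its block -/
def FreeAt (G : SimpleGraph V) (l : List V) (D a : ℕ) (w : V) : Prop :=
  ∃ i j u v, i < l.idxOf w ∧ l.idxOf w < j ∧ l[i]? = some u ∧ l[j]? = some v ∧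
    i / D = l.idxOf w / D ∧ j / D = l.idxOf w / D ∧ i % 2 = j % 2 ∧ u ≠ v ∧
    a ≤ (cmn G u v).card

theorem freeable {l : List V} (hl : l.Nodup) (A : Finset V) (B : Finset ℕ) {m a D : ℕ}
    (H : Hyp G m a) (hm : 0 < m) (hD : 0 < D)
    (hnum : B.card * D + (2 * m - 2) * (2 * (Fintype.card V / D + 1)) < A.card) :
    ∃ w ∈ A, w ∉ l ∨ (w ∈ l ∧ l.idxOf w / D ∉ B ∧ FreeAt G l D a w) := by
  by_cases hz : ∃ w ∈ A, w ∉ l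
  · obtain ⟨w, h1, h2⟩ := hz
    exact ⟨w, h1, Or.inl h2⟩
  push Not at hz
  have hcard := idx_image_card _ hz
  obtain ⟨β, hβ, I0, hI0, hI0c, hI0b, hI0p⟩ := pigeon
    (A.image (fun x => l.idxOf x)) (Fintype.card V) D (2 * m - 2) B (by
      intro i hi
      rw [mem_image] at hi
      obtain ⟨x, hx, rfl⟩ := hi
      exact lt_of_lt_of_le (List.idxOf_lt_length_of_mem (hz x hx)) (nodup_len hl)) hD (by
      rw [hcard]; exact hnum)
  have hv : ∀ i ∈ I0, ∃ x ∈ A, l.idxOf x = i := by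
    intro i hi
    have := hI0 hi
    rw [mem_image] at this
    exact this
  let s := I0.orderEmbOfFin rfl
  have hs : ∀ k, s k ∈ I0 := fun k => I0.orderEmbOfFin_mem rfl k
  have hlt : ∀ k k', k < k' → s k < s k' := fun k k' h => s.strictMono h
  let f : Fin m → Fin I0.card := fun k => ⟨2 * k.1, by have := k.2; omega⟩
  choose g hgA hg using fun k : Fin m => hv (s (f k)) (hs _)
  have hginj : Function.Injective g := by
    intro k k' hkk
    have h1 := hg k
    rw [hkk, hg k'] at h1
    have h2 := s.injective h1
    simp only [f, Fin.mk.injEq] at h2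
    ext; omega
  have hex : ∃ k k' : Fin m, k < k' ∧ a ≤ (cmn G (g k) (g k')).card := by
    obtain ⟨u, hu, v, hv, huv, h1⟩ := H (univ.image g) (by
      rw [card_image_of_injective _ hginj]; simp)
    rw [mem_image] at hu hv
    obtain ⟨k, -, rfl⟩ := hu
    obtain ⟨k', -, rfl⟩ := hv
    have hne : k ≠ k' := fun h => huv (by rw [h])
    rcases lt_or_gt_of_ne hne with h2 | h2
    · exact ⟨k, k', h2, h1⟩
    · exact ⟨k', k, h2, by rw [cmn_comm]; exact h1⟩
  obtain ⟨k, k', hkk, hgood⟩ := hex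
  have hkk' : k.1 < k'.1 := hkk
  have hk'2 := k'.2
  let p : Fin I0.card := ⟨2 * k.1 + 1, by omega⟩
  obtain ⟨w, hwA, hw⟩ := hv (s p) (hs p)
  refine ⟨w, hwA, Or.inr ⟨hz w hwA, ?_, ?_⟩⟩
  · rw [hw, hI0b _ (hs p)]; exact hβ
  · refine ⟨s (f k), s (f k'), g k, g k', ?_, ?_, ?_, ?_, ?_, ?_, ?_, ?_, hgood⟩
    · rw [hw]; apply hlt; simp [f, p, Fin.lt_def]
    · rw [hw]; apply hlt; simp only [f, p, Fin.lt_def]; omega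
    · rw [← hg k]; exact get_idx (hz _ (hgA k))
    · rw [← hg k']; exact get_idx (hz _ (hgA k'))
    · rw [hw, hI0b _ (hs _), hI0b _ (hs _)]
    · rw [hw, hI0b _ (hs _), hI0b _ (hs _)]
    · exact hI0p _ (hs _) _ (hs _)
    · intro h
      have := hginj h
      omega

end ops2
end EC
set_option linter.unusedSectionVars false
namespace EC
section gadget
open Finset
variable {V : Type*} [Fintype V] [DecidableEq V] {G : SimpleGraph V}

def AV (l : List V) (E : List (Sym2 V)) (D b : ℕ) : Prop :=
  ∀ k y, l[k]? = some y → k / D = b → ∀ f ∈ E, y ∉ f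

theorem St.insertR {l : List V} {E : List (Sym2 V)} {R : Finset V} (h : St G l E R) {x : V}
    (hx : x ∉ l) : St G l E (insert x R) where
  nd := h.nd
  end_ := h.end_
  sub := h.sub
  adj := h.adj
  par := h.par
  off := by
    intro y hy hy2
    rw [mem_insert] at hy2
    rcases hy2 with rfl | hy2
    · exact hx hy
    · exact h.off y hy hy2
  len := h.len

theorem St.pend {l : List V} {E : List (Sym2 V)} {R : Finset V} {D a : ℕ} {x : V}
    (h : St G l E R) (hx : x ∈ l) (hF : FreeAt G l D a x) (hD : 0 < D)
    (hAV : AV l E D (l.idxOf x / D)) (hlen : D + 3 ≤ l.length) :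
    ∃ l' p q, St G l' (s(p, q) :: E) (insert x R) ∧ p ≠ q ∧ a ≤ (cmn G p q).card ∧
      l.length ≤ l'.length + D ∧ l.idxOf p / D = l.idxOf x / D ∧ l.idxOf q / D = l.idxOf x / D ∧
      ∀ k, k / D < l.idxOf x / D → l'[k]? = l[k]? := by
  obtain ⟨i, j, u, v, hi, hj, hu, hv, hib, hjb, hpar, huv, hgood⟩ := hF
  obtain ⟨A, int, B, hs, hA, hint, hix⟩ := split_at l i j u v hu hv (by omega)
  have hjiD : j < i + D := by
    have h1 := Nat.div_add_mod i D
    have h2 := Nat.div_add_mod j D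
    have h3 := Nat.mod_lt j hD
    rw [hib] at h1; rw [hjb] at h2; omega
  have hlen2 := congrArg List.length hs
  simp only [List.length_append, List.length_cons] at hlen2
  have hlenl' : (A ++ u :: v :: B).length + int.length = l.length := by
    rw [hlen2]; simp; omega
  have hnd := h.nd
  have hxint : x ∈ int := by
    have h1 := get_idx hx
    rw [hs] at h1 hx
    have h2 : x ∈ A ∨ x = u ∨ x ∈ int ∨ x = v ∨ x ∈ B := by simpa using hx
    have e1 : (A ++ u :: (int ++ v :: B)) = l := hs.symm
    rcases h2 with h2 | h2 | h2 | h2 | h2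
    · exfalso
      obtain ⟨k, hk, hk2⟩ := List.getElem_of_mem h2
      have : l[k]? = some x := by
        rw [hs, List.getElem?_append_left hk, List.getElem?_eq_getElem hk, hk2]
      have := idx_eq hnd this
      omega
    · exfalso; rw [h2] at hi; rw [idx_eq hnd hu] at hi; omega
    · exact h2
    · exfalso; rw [h2] at hj; rw [idx_eq hnd hv] at hj; omega
    · exfalso
      obtain ⟨k, hk, hk2⟩ := List.getElem_of_mem h2
      have : l[j + 1 + k]? = some x := by
        have e2 : A ++ u :: (int ++ v :: B) = (A ++ u :: (int ++ [v])) ++ B := by simp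
        rw [hs, e2, List.getElem?_append_right (by simp; omega)]
        have : j + 1 + k - (A ++ u :: (int ++ [v])).length = k := by simp; omega
        rw [this, List.getElem?_eq_getElem hk, hk2]
      have := idx_eq hnd this
      omega
  have h1 : St G (A ++ u :: v :: B) (s(u, v) :: E) R := by
    rw [hs] at h
    refine h.addPending ?_ ?_ (by omega)
    · rw [hint, Nat.odd_iff]; omega
    · intro f hf y hy hy2
      simp only [List.mem_cons, List.mem_append, List.not_mem_nil, or_false] at hy2
      rcases hy2 with rfl | hy2 | rfl
      · exact hAV i y hu hib f hf hy
      · obtain ⟨k, hk1, hk2, hk3⟩ := hix y hy2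
        refine hAV k y hk3 ?_ f hf hy
        have h1 := Nat.div_le_div_right (c := D) hk1.le
        have h2 := Nat.div_le_div_right (c := D) hk2.le
        omega
      · exact hAV j y hv hjb f hf hy
  refine ⟨A ++ u :: v :: B, u, v, h1.insertR ?_, huv, hgood, by omega, ?_, ?_, ?_⟩
  · intro hx2
    rw [hs] at hnd
    have hd : (u :: int ++ v :: B).Nodup := by
      have := (List.nodup_append.1 hnd).2.1
      simpa using this
    have hA2 := (List.nodup_append.1 hnd).2.2
    have hd2 := (List.nodup_append.1 hd).2.2
    have hd3 := (List.nodup_cons.1 (List.nodup_append.1 hd).1).1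
    simp only [List.mem_append, List.mem_cons] at hx2
    rcases hx2 with h2 | rfl | rfl | h2
    · exact hA2 x h2 x (by simp [hxint]) rfl
    · exact hd3 hxint
    · exact hd2 x (by simp [hxint]) x (by simp) rfl
    · exact hd2 x (by simp [hxint]) x (by simp [h2]) rfl
  · rw [idx_eq hnd hu]; exact hib
  · rw [idx_eq hnd hv]; exact hjb
  · intro k hk
    have hki : k < i := by
      by_contra hcon
      have := Nat.div_le_div_right (c := D) (not_lt.1 hcon)
      omega
    rw [hs, List.getElem?_append_left (by omega), List.getElem?_append_left (by omega)]

theorem St.freeOne {l : List V} {E : List (Sym2 V)} {R : Finset V} {D De a : ℕ} {x : V}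
    (h : St G l E R) (hx : x ∉ l ∨ (x ∈ l ∧ AV l E D (l.idxOf x / D) ∧ FreeAt G l D a x))
    (hD : 0 < D) (hDe : 0 < De) (hlen : D + De + 3 ≤ l.length)
    (hnum : R.card + 1 + 2 * E.length * De + 2 * (Fintype.card V / De + 1) < a) :
    ∃ l', St G l' E (insert x R) ∧ l.length ≤ l'.length + D + De := by
  rcases hx with hx | ⟨hx, hAV, hF⟩
  · exact ⟨l, h.insertR hx, by omega⟩
  · obtain ⟨l', p, q, h1, hpq, hgood, hl', -⟩ := h.pend hx hF hD hAV (by omega)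
    have hc := card_insert_le x R
    obtain ⟨l'', h2, -, h3⟩ := h1.resolve (De := De) hpq hgood hDe (by omega) (by omega)
    exact ⟨l'', h2, by omega⟩

theorem St.freeTwo {l : List V} {E : List (Sym2 V)} {R : Finset V} {D De a : ℕ} {x x' : V}
    (h : St G l E R)
    (hx : x ∉ l ∨ (x ∈ l ∧ AV l E D (l.idxOf x / D) ∧ FreeAt G l D a x))
    (hx' : x' ∉ l ∨ (x' ∈ l ∧ AV l E D (l.idxOf x' / D) ∧ FreeAt G l D a x'))
    (hne : x ∈ l → x' ∈ l → l.idxOf x / D ≠ l.idxOf x' / D)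
    (hD : 0 < D) (hDe : 0 < De) (hlen : 2 * D + 2 * De + 3 ≤ l.length)
    (hnum : R.card + 2 + 2 * (E.length + 1) * De + 2 * (Fintype.card V / De + 1) < a) :
    ∃ l', St G l' E (insert x (insert x' R)) ∧ l.length ≤ l'.length + 2 * D + 2 * De := by
  have hmono : 2 * E.length * De ≤ 2 * (E.length + 1) * De := Nat.mul_le_mul_right _ (by omega)
  have hc := card_insert_le x R
  have hc' := card_insert_le x' R
  have hcc := card_insert_le x (insert x' R)
  by_cases h1 : x ∈ l
  · by_cases h2 : x' ∈ l
    · have hlt := lt_or_gt_of_ne (hne h1 h2)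
      clear hne
      wlog hlt' : l.idxOf x / D < l.idxOf x' / D generalizing x x'
      · have := this hx' hx hc' hc (card_insert_le _ _) h2 h1 hlt.symm
          (hlt.resolve_left hlt')
        rwa [Finset.insert_comm] at this
      have hxx := hx.resolve_left (not_not.2 h1)
      have hxx' := hx'.resolve_left (not_not.2 h2)
      obtain ⟨l2, p, q, a1, hpq, hgood, a2, hbp, hbq, hpre⟩ :=
        h.pend h2 hxx'.2.2 hD hxx'.2.1 (by omega)
      have hg1 : l2[l.idxOf x]? = some x := by rw [hpre _ hlt']; exact get_idx h1
      have hidx : l2.idxOf x = l.idxOf x := idx_eq a1.nd hg1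
      have hF2 : FreeAt G l2 D a x := by
        obtain ⟨i, j, u, v, hi, hj, hu, hv, hib, hjb, rest⟩ := hxx.2.2
        refine ⟨i, j, u, v, ?_⟩
        rw [hidx, hpre i (by omega), hpre j (by omega)]
        exact ⟨hi, hj, hu, hv, hib, hjb, rest⟩
      have hAV2 : AV l2 (s(p, q) :: E) D (l2.idxOf x / D) := by
        intro k y hk hkb f hf hy
        rw [hidx] at hkb
        rw [hpre k (by omega)] at hk
        rw [List.mem_cons] at hf
        rcases hf with rfl | hf
        · have := idx_eq h.nd hk
          rw [Sym2.mem_iff] at hy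
          rcases hy with rfl | rfl
          · rw [this] at hbp; omega
          · rw [this] at hbq; omega
        · exact hxx.2.1 k y hk hkb f hf hy
      have hxl2 : x ∈ l2 := List.mem_iff_getElem?.2 ⟨_, hg1⟩
      obtain ⟨l3, b1, b2⟩ := a1.freeOne (De := De) (Or.inr ⟨hxl2, hAV2, hF2⟩) hD hDe (by omega)
        (by simp only [List.length_cons]; omega)
      obtain ⟨l4, c1, -, c2⟩ := b1.resolve (De := De) hpq hgood hDe (by omega) (by omega)
      exact ⟨l4, c1, by omega⟩
    · obtain ⟨l', a1, a2⟩ := (h.insertR h2).freeOne (De := De) hx hD hDe (by omega) (by omega)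
      exact ⟨l', a1, by omega⟩
  · obtain ⟨l', a1, a2⟩ := (h.insertR h1).freeOne (De := De) hx' hD hDe (by omega) (by omega)
    rw [Finset.insert_comm] at a1
    exact ⟨l', a1, by omega⟩

structure Gd (V : Type*) where
  u : V
  v : V
  x : V
  y : V
  w : V

def Gd.e (g : Gd V) : Sym2 V := s(g.u, g.v)
def Gd.ps (g : Gd V) : List V := [g.x, g.y, g.w]
def Gd.ok (G : SimpleGraph V) (g : Gd V) : Prop :=
  g.u ≠ g.v ∧ G.Adj g.u g.x ∧ G.Adj g.v g.x ∧ G.Adj g.u g.w ∧ G.Adj g.v g.w ∧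
    G.Adj g.x g.y ∧ G.Adj g.w g.y

theorem exists_AV (l : List V) (hl : l.Nodup) (E : List (Sym2 V)) (D : ℕ) :
    ∃ B : Finset ℕ, B.card ≤ 2 * E.length ∧ ∀ b, b ∉ B → AV l E D b := by
  obtain ⟨Q, hQ1, hQ2⟩ := exists_verts E
  refine ⟨Q.image (fun x => l.idxOf x / D), card_image_le.trans hQ1, ?_⟩
  intro b hb k y hk hkb f hf hy
  apply hb
  rw [mem_image]
  exact ⟨y, hQ2 f hf y hy, by rw [idx_eq hl hk]; exact hkb⟩

theorem gadget {l : List V} {E : List (Sym2 V)} {R : Finset V} {m D De a eE rR : ℕ}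
    (h : St G l E R) (H : Hyp G m a) (hm : 0 < m) (hD : 0 < D) (hDe : 0 < De)
    (hE : E.length + 3 ≤ eE) (hR : R.card + 3 ≤ rR)
    (hr : rR + 2 * eE * De + 2 * (Fintype.card V / De + 1) < a)
    (hf : rR + m + (2 * eE + m) * D + (2 * m - 2) * (2 * (Fintype.card V / D + 1)) < a)
    (hlen : (2 * eE + 1) * (4 * m) + 4 * m + 3 * D + 3 * De + 3 ≤ l.length) :
    ∃ l', ∃ g : Gd V, St G l' (g.e :: E) (insert g.y (insert g.x (insert g.w R))) ∧ g.ok G ∧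
      g.ps.Nodup ∧ (∀ z ∈ g.ps, z ∉ R) ∧
      l.length ≤ l'.length + (4 * m + 3 * D + 3 * De) := by
  obtain ⟨A, u, int, v, B, hs, hodd, h3, h4m, hav, huv, hgood⟩ :=
    findSeg (E := E) h.nd H hm (by
      have : (2 * E.length + 1) * (4 * m) ≤ (2 * eE + 1) * (4 * m) :=
        Nat.mul_le_mul_right _ (by omega)
      omega)
  have hlen2 := congrArg List.length hs
  simp only [List.length_append, List.length_cons] at hlen2
  have hl1 : (A ++ u :: v :: B).length + int.length = l.length := by
    rw [hlen2]; simp; omega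
  have h1 : St G (A ++ u :: v :: B) (s(u, v) :: E) R := by
    rw [hs] at h
    exact h.addPending hodd hav (by omega)
  set l1 := A ++ u :: v :: B with hl1def
  obtain ⟨B0, hB0c, hB0⟩ := exists_AV l1 h1.nd (s(u, v) :: E) D
  simp only [List.length_cons] at hB0c
  have mono1 : 2 * (E.length + 1 + 1) * De ≤ 2 * eE * De := Nat.mul_le_mul_right _ (by omega)
  have mono2 : 2 * (E.length + 1) * De ≤ 2 * eE * De := Nat.mul_le_mul_right _ (by omega)
  have hX : ∀ k ≤ m, ∃ X : Finset V, X.card = k ∧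
      (∀ x ∈ X, x ∈ cmn G u v ∧ x ∉ R ∧
        (x ∉ l1 ∨ (x ∈ l1 ∧ AV l1 (s(u, v) :: E) D (l1.idxOf x / D) ∧ FreeAt G l1 D a x))) ∧
      (∀ x ∈ X, ∀ x' ∈ X, x ≠ x' → x ∈ l1 → x' ∈ l1 → l1.idxOf x / D ≠ l1.idxOf x' / D) := by
    intro k
    induction k with
    | zero => intro _; exact ⟨∅, by simp, by simp, by simp⟩
    | succ k ih =>
      intro hk
      obtain ⟨X, hXc, hX1, hX2⟩ := ih (by omega)
      obtain ⟨w, hw, hw2⟩ := freeable h1.nd ((cmn G u v \ R) \ X)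
        (B0 ∪ X.image (fun x => l1.idxOf x / D)) H hm hD (by
          have c1 := le_card_sdiff X (cmn G u v \ R)
          have c2 := le_card_sdiff R (cmn G u v)
          have c3 := card_union_le B0 (X.image (fun x => l1.idxOf x / D))
          have c4 := card_image_le (s := X) (f := fun x => l1.idxOf x / D)
          have c5 : (B0 ∪ X.image (fun x => l1.idxOf x / D)).card * D ≤ (2 * eE + m) * D :=
            Nat.mul_le_mul_right _ (by omega)
          omega)
      rw [mem_sdiff, mem_sdiff] at hw
      refine ⟨insert w X, ?_, ?_, ?_⟩
      · rw [card_insert_of_notMem hw.2, hXc]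
      · intro x hx
        rw [mem_insert] at hx
        rcases hx with rfl | hx
        · refine ⟨hw.1.1, hw.1.2, ?_⟩
          rcases hw2 with hw2 | ⟨hw2, hw3, hw4⟩
          · exact Or.inl hw2
          · refine Or.inr ⟨hw2, hB0 _ ?_, hw4⟩
            intro hh; exact hw3 (mem_union_left _ hh)
        · exact hX1 x hx
      · have key : ∀ x ∈ X, w ∈ l1 → l1.idxOf w / D ≠ l1.idxOf x / D := by
          intro x hx hwl heq
          rcases hw2 with hw2 | ⟨hw2, hw3, hw4⟩
          · exact hw2 hwl
          · apply hw3
            rw [heq]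
            exact mem_union_right _ (mem_image_of_mem (fun x => l1.idxOf x / D) hx)
        intro x hx x' hx' hne hxl hxl'
        rw [mem_insert] at hx hx'
        rcases hx with rfl | hx
        · rcases hx' with rfl | hx'
          · exact absurd rfl hne
          · exact key x' hx' hxl
        · rcases hx' with rfl | hx'
          · exact (key x hx hxl').symm
          · exact hX2 x hx x' hx' hne hxl hxl'
  obtain ⟨X, hXc, hX1, hX2⟩ := hX m le_rfl
  obtain ⟨x, hx, x', hx', hxx, hxgood⟩ := H X hXc.ge
  obtain ⟨hxW, hxR, hxF⟩ := hX1 x hx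
  obtain ⟨hxW', hxR', hxF'⟩ := hX1 x' hx'
  obtain ⟨l3, s3, len3⟩ := h1.freeTwo (De := De) hxF hxF' (hX2 x hx x' hx' hxx) hD hDe
    (by omega) (by simp only [List.length_cons]; omega)
  have hc1 := card_insert_le x (insert x' R)
  have hc2 := card_insert_le x' R
  obtain ⟨B1, hB1c, hB1⟩ := exists_AV l3 s3.nd (s(u, v) :: E) D
  simp only [List.length_cons] at hB1c
  obtain ⟨y, hy, hy2⟩ := freeable s3.nd (cmn G x x' \ (insert x (insert x' R))) B1 H hm hD (by
    have c1 := le_card_sdiff (insert x (insert x' R)) (cmn G x x')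
    have c5 : B1.card * D ≤ (2 * eE + m) * D := Nat.mul_le_mul_right _ (by omega)
    omega)
  rw [mem_sdiff] at hy
  obtain ⟨l4, s4, len4⟩ := s3.freeOne (De := De) (x := y) (a := a) (by
      rcases hy2 with hy2 | ⟨hy2, hy3, hy4⟩
      · exact Or.inl hy2
      · exact Or.inr ⟨hy2, hB1 _ hy3, hy4⟩) hD hDe (by omega)
      (by simp only [List.length_cons]; omega)
  rw [mem_cmn] at hxW hxW'
  have hyx := mem_cmn.1 hy.1
  refine ⟨l4, ⟨u, v, x, y, x'⟩, s4, ?_, ?_, ?_, by omega⟩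
  · exact ⟨huv, hxW.1, hxW.2, hxW'.1, hxW'.2, hyx.1, hyx.2⟩
  · simp only [Gd.ps, List.nodup_cons, List.mem_cons, List.not_mem_nil, or_false, not_or,
      not_false_eq_true, List.nodup_nil, and_true]
    exact ⟨⟨hyx.1.ne, hxx⟩, hyx.2.ne.symm⟩
  · intro z hz
    simp only [Gd.ps, List.mem_cons, List.not_mem_nil, or_false] at hz
    rcases hz with rfl | rfl | rfl
    · exact hxR
    · intro hh; exact hy.2 (by simp [hh])
    · exact hxR'

end gadget
end EC
set_option linter.unusedSectionVars false
namespace EC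
section fin
open Finset
variable {V : Type*} [Fintype V] [DecidableEq V] {G : SimpleGraph V}

theorem walk_of_list (b : V) : ∀ (l : List V) (a : V),
    (∀ e ∈ edg (a :: (l ++ [b])), e ∈ G.edgeSet) →
    ∃ w : G.Walk a b, w.support = a :: (l ++ [b]) ∧ w.edges = edg (a :: (l ++ [b])) := by
  intro l
  induction l with
  | nil =>
    intro a h
    have hab : G.Adj a b := by
      have := h s(a, b) (by simp [edg])
      simpa using this
    exact ⟨SimpleGraph.Walk.cons hab SimpleGraph.Walk.nil, by simp, by simp [edg]⟩
  | cons c l ih =>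
    intro a h
    have hac : G.Adj a c := by
      have := h s(a, c) (by simp [edg])
      simpa using this
    obtain ⟨w, h1, h2⟩ := ih c (fun e he => h e (by simp [edg] at he ⊢; exact Or.inr he))
    refine ⟨SimpleGraph.Walk.cons hac w, by simp [h1], by simp [h2, edg]⟩

theorem St.toCycle {l : List V} {R : Finset V} (h : St G l [] R) : HasCycleLen G l.length := by
  obtain ⟨v, mid, u, rfl⟩ : ∃ v mid u, l = v :: (mid ++ [u]) := by
    have h3 := h.len
    rcases l with _ | ⟨v, t⟩
    · simp at h3
    · rcases List.eq_nil_or_concat t with rfl | ⟨mid, u, rfl⟩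
      · simp at h3
      · exact ⟨v, mid, u, by simp⟩
  have h3 := h.len
  simp at h3
  have hnd := h.nd
  have hall : ∀ e ∈ CE (v :: (mid ++ [u])), e ∈ G.edgeSet := by
    intro e he
    simpa using h.adj e he
  have huv : G.Adj u v := by
    have := hall s(u, v) ((mem_CE_form _ _ _ _).2 (Or.inr rfl))
    simpa using this
  obtain ⟨w, h1, h2⟩ := walk_of_list u mid v
    (fun e he => hall e ((mem_CE_form _ _ _ _).2 (Or.inl he)))
  refine ⟨u, SimpleGraph.Walk.cons huv w, ?_, ?_⟩
  · rw [SimpleGraph.Walk.cons_isCycle_iff]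
    refine ⟨?_, ?_⟩
    · rw [SimpleGraph.Walk.isPath_def, h1]; exact hnd
    · rw [h2]; exact not_mem_inner mid u v huv.ne hnd (by omega)
  · have := congrArg List.length h1
    rw [SimpleGraph.Walk.length_support] at this
    rw [SimpleGraph.Walk.length_cons, this]

theorem edges_eq {a b : V} (p : G.Walk a b) : p.edges = edg p.support := by
  induction p with
  | nil => simp [edg]
  | cons h p ih =>
    rw [SimpleGraph.Walk.edges_cons, SimpleGraph.Walk.support_cons, ih]
    cases p <;> simp [edg]

theorem support_form {a b : V} (p : G.Walk a b) (hp : 1 ≤ p.length) :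
    ∃ mid, p.support = a :: (mid ++ [b]) := by
  induction p with
  | nil => simp at hp
  | cons h p ih =>
    cases p with
    | nil => exact ⟨[], by simp⟩
    | cons h' p' =>
      obtain ⟨mid, hm⟩ := ih (by simp)
      exact ⟨_ :: mid, by rw [SimpleGraph.Walk.support_cons, hm]; rfl⟩

theorem St.ofCycle {v : V} (w : G.Walk v v) (hw : w.IsCycle) (he : Even w.length) :
    ∃ l, St G l [] ∅ ∧ l.length = w.length := by
  have h3 := hw.three_le_length
  cases w with
  | nil => simp at h3
  | cons h p =>
    rw [SimpleGraph.Walk.cons_isCycle_iff] at hw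
    rw [SimpleGraph.Walk.length_cons] at h3 he
    obtain ⟨mid, hm⟩ := support_form p (by omega)
    have hl : p.support.length = p.length + 1 := SimpleGraph.Walk.length_support p
    refine ⟨p.support, ?_, by rw [hl]; simp⟩
    refine ⟨?_, by simp, by simp, ?_, by simpa [hl] using he, by simp, by omega⟩
    · exact (SimpleGraph.Walk.isPath_def p).1 hw.1
    · intro e he
      right
      rw [hm, mem_CE_form, ← hm, ← edges_eq] at he
      rcases he with he | rfl
      · exact p.edges_subset_edgeSet he
      · exact h

theorem expand_all : ∀ (gs : List (Gd V)) (l : List V) (R : Finset V) (j : ℕ),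
    St G l (gs.map Gd.e) R → (∀ g ∈ gs, g.ok G) → (gs.flatMap Gd.ps).Nodup →
    (∀ x ∈ gs.flatMap Gd.ps, x ∈ R) → j ≤ gs.length →
    ∃ l' R', St G l' [] R' ∧ l'.length = l.length + gs.length + 2 * j := by
  intro gs
  induction gs with
  | nil =>
    intro l R j h _ _ _ hj
    exact ⟨l, R, h, by simp at hj ⊢; exact hj⟩
  | cons g gs ih =>
    intro l R j h hok hnd hR hj
    obtain ⟨huv, h1, h2, h3, h4, h5, h6⟩ := hok g (by simp)
    rw [List.flatMap_cons, List.nodup_append] at hnd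
    obtain ⟨hn1, hn2, hn3⟩ := hnd
    have key : ∀ (p : List V) (j' : ℕ), p.Nodup → Odd p.length → (∀ x ∈ p, x ∈ g.ps) →
        (∀ e ∈ edg (g.u :: (p ++ [g.v])), e ∈ G.edgeSet) → j' ≤ gs.length →
        p.length = 1 + 2 * (j - j') → j' ≤ j →
        ∃ l' R', St G l' [] R' ∧ l'.length = l.length + (g :: gs).length + 2 * j := by
      intro p j' hp hodd hps hadj hj' hpl hjj
      have h' : St G l (s(g.u, g.v) :: gs.map Gd.e) R := h
      obtain ⟨l', hl', hlen, -⟩ := h'.expand (p := p) (R' := R \ p.toFinset) huv hp hodd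
        (fun x hx hxl => h.off x hxl (hR x (by
          rw [List.flatMap_cons, List.mem_append]; exact Or.inl (hps x hx))))
        hadj (by simp; tauto) sdiff_subset
      obtain ⟨l2, R2, hs, hl2⟩ := ih l' _ j' hl' (fun g' hg' => hok g' (by simp [hg'])) hn2 (by
        intro x hx
        rw [mem_sdiff]
        refine ⟨hR x ?_, ?_⟩
        · rw [List.flatMap_cons, List.mem_append]; exact Or.inr hx
        · intro hxp
          exact hn3 x (hps x (by simpa using hxp)) x hx rfl) hj'
      refine ⟨l2, R2, hs, ?_⟩
      rw [hl2, hlen, hpl, List.length_cons]; omega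
    simp only [List.length_cons] at hj
    rcases Nat.eq_zero_or_pos j with rfl | hj0
    · apply key [g.x] 0 (by simp) (by simp) (by simp [Gd.ps]) _ (by omega) (by simp) le_rfl
      intro e he
      simp [edg] at he
      rcases he with rfl | rfl
      · exact h1
      · exact h2.symm
    · apply key [g.x, g.y, g.w] (j - 1) hn1 ⟨1, rfl⟩ (by simp [Gd.ps]) _ (by omega)
        (by simp; omega) (by omega)
      intro e he
      simp [edg] at he
      rcases he with rfl | rfl | rfl | rfl
      · exact h1
      · exact h5
      · exact h6.symm
      · exact h4.symm

theorem many {l : List V} {m D De a M : ℕ}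
    (h : St G l [] ∅) (H : Hyp G m a) (hm : 0 < m) (hD : 0 < D) (hDe : 0 < De)
    (hr : (3 * M + 3) + 2 * (M + 3) * De + 2 * (Fintype.card V / De + 1) < a)
    (hf : (3 * M + 3) + m + (2 * (M + 3) + m) * D +
      (2 * m - 2) * (2 * (Fintype.card V / D + 1)) < a)
    (hlen : (2 * (M + 3) + 1) * (4 * m) + 4 * m + 3 * D + 3 * De + 3 + 
      M * (4 * m + 3 * D + 3 * De) ≤ l.length) :
    ∀ j ≤ M, ∃ (gs : List (Gd V)) (l' : List V) (R : Finset V), gs.length = j ∧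
      St G l' (gs.map Gd.e) R ∧ (∀ g ∈ gs, g.ok G) ∧ (gs.flatMap Gd.ps).Nodup ∧
      (∀ x ∈ gs.flatMap Gd.ps, x ∈ R) ∧ R.card ≤ 3 * j ∧
      l.length ≤ l'.length + j * (4 * m + 3 * D + 3 * De) := by
  intro j
  induction j with
  | zero => intro _; exact ⟨[], l, ∅, by simp [h]⟩
  | succ j ih =>
    intro hj
    obtain ⟨gs, l1, R, hgl, hs, hok, hnd, hR, hRc, hl1⟩ := ih (by omega)
    have hmul : j * (4 * m + 3 * D + 3 * De) ≤ M * (4 * m + 3 * D + 3 * De) :=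
      Nat.mul_le_mul_right _ (by omega)
    obtain ⟨l2, g, hs2, hgok, hgnd, hgR, hl2⟩ := gadget (eE := M + 3) (rR := 3 * M + 3) hs H hm hD
      hDe (by simp [hgl]; omega) (by omega) hr hf (by omega)
    refine ⟨g :: gs, l2, _, by simp [hgl], hs2, ?_, ?_, ?_, ?_, ?_⟩
    · intro g' hg'
      rw [List.mem_cons] at hg'
      rcases hg' with rfl | hg'
      · exact hgok
      · exact hok g' hg'
    · rw [List.flatMap_cons, List.nodup_append]
      refine ⟨hgnd, hnd, ?_⟩
      rintro x hx y hy rfl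
      exact hgR x hx (hR x hy)
    · intro x hx
      rw [List.flatMap_cons, List.mem_append] at hx
      rcases hx with hx | hx
      · simp [Gd.ps] at hx ⊢; tauto
      · have := hR x hx
        simp [this]
    · have c1 := card_insert_le g.y (insert g.x (insert g.w R))
      have c2 := card_insert_le g.x (insert g.w R)
      have c3 := card_insert_le g.w R
      omega
    · rw [Nat.succ_mul]; omega

theorem shorten {m De a M t : ℕ} (gs : List (Gd V)) (R : Finset V) (hgl : gs.length = M)
    (H : Hyp G m a) (hm : 0 < m) (hDe : 0 < De)
    (hok : ∀ g ∈ gs, g.ok G) (hnd : (gs.flatMap Gd.ps).Nodup)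
    (hR : ∀ x ∈ gs.flatMap Gd.ps, x ∈ R) (hRc : R.card ≤ 3 * M) (ht : Even t)
    (hM : 4 * m + De ≤ 2 * M)
    (hr : (3 * M + 3) + 2 * (M + 3) * De + 2 * (Fintype.card V / De + 1) < a)
    (hT : (2 * M + 1) * (4 * m) + 4 * m + De + 3 + M ≤ t) :
    ∀ N (l : List V), l.length ≤ N → St G l (gs.map Gd.e) R → t ≤ l.length + 3 * M →
      HasCycleLen G t := by
  intro N
  induction N with
  | zero =>
    intro l hl h _
    have := h.len
    omega
  | succ N ih =>
    intro l hl h htl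
    have hpar := h.par
    rw [List.length_map, hgl] at hpar
    by_cases hc : l.length + M ≤ t
    · obtain ⟨q, hq⟩ : Even (t - (l.length + M)) := (Nat.even_sub hc).2 (by simp [ht, hpar])
      obtain ⟨l', R', hs, hlen⟩ := expand_all gs l R q h hok hnd hR (by omega)
      have := hs.toCycle
      rw [hlen] at this
      convert this using 1
      omega
    · have hge : t + 2 ≤ l.length + M := by
        obtain ⟨q, hq⟩ := ht
        obtain ⟨q', hq'⟩ := hpar
        omega
      obtain ⟨A, u, int, v, B, hs, hodd, h3, h4m, hav, huv, hgood⟩ :=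
        findSeg (E := gs.map Gd.e) h.nd H hm (by rw [List.length_map, hgl]; omega)
      have hl1 : (A ++ u :: v :: B).length + int.length = l.length := by
        rw [hs]; simp; omega
      have h1 : St G (A ++ u :: v :: B) (s(u, v) :: gs.map Gd.e) R := by
        rw [hs] at h
        exact h.addPending hodd hav (by omega)
      have mono : 2 * M * De ≤ 2 * (M + 3) * De := Nat.mul_le_mul_right _ (by omega)
      obtain ⟨l2, hs2, ha, hb⟩ := h1.resolve (De := De) huv hgood hDe
        (by rw [List.length_map, hgl]; omega) (by omega)
      exact ih l2 (by omega) hs2 (by omega)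

theorem large {l : List V} {m D De a M t : ℕ}
    (h : St G l [] ∅) (H : Hyp G m a) (hm : 0 < m) (hD : 0 < D) (hDe : 0 < De)
    (hr : (3 * M + 3) + 2 * (M + 3) * De + 2 * (Fintype.card V / De + 1) < a)
    (hf : (3 * M + 3) + m + (2 * (M + 3) + m) * D +
      (2 * m - 2) * (2 * (Fintype.card V / D + 1)) < a)
    (hlen : (2 * (M + 3) + 1) * (4 * m) + 4 * m + 3 * D + 3 * De + 3 + 
      M * (4 * m + 3 * D + 3 * De) + t ≤ l.length) (ht : Even t)
    (hM : 4 * m + De ≤ 2 * M)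
    (hT : (2 * M + 1) * (4 * m) + 4 * m + De + 3 + M ≤ t) : HasCycleLen G t := by
  obtain ⟨gs, l', R, hgl, hs, hok, hnd, hR, hRc, hl⟩ :=
    many h H hm hD hDe hr hf (by omega) M le_rfl
  exact shorten gs R hgl H hm hDe hok hnd hR hRc ht hM hr hT _ l' le_rfl hs (by omega)

end fin
end EC
set_option linter.unusedSectionVars false
namespace EC
section small
open Finset
variable {V : Type*} [Fintype V] [DecidableEq V] {G : SimpleGraph V}

def Ind (r : V → V → Prop) (m : ℕ) (S : Finset V) : Prop :=
  ∀ T ⊆ S, m ≤ T.card → ∃ u ∈ T, ∃ v ∈ T, u ≠ v ∧ r u v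

theorem Ind.step {r : V → V → Prop} (hr : ∀ x y, r x y → r y x) {m : ℕ} {S S' : Finset V}
    (h : Ind r (m + 1) S) (v : V) (hv : v ∈ S) (hS : S' ⊆ S) (hvS : v ∉ S')
    (hno : ∀ x ∈ S', ¬ r v x) : Ind r m S' := by
  intro T hT hTc
  have hvT : v ∉ T := fun hh => hvS (hT hh)
  obtain ⟨x, hx, y, hy, hxy, hrr⟩ := h (insert v T)
    (by intro z hz; rw [mem_insert] at hz; rcases hz with rfl | hz; exacts [hv, hS (hT hz)])
    (by rw [card_insert_of_notMem hvT]; omega)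
  rw [mem_insert] at hx hy
  rcases hx with rfl | hx
  · rcases hy with rfl | hy
    · exact absurd rfl hxy
    · exact absurd hrr (hno y (hT hy))
  · rcases hy with rfl | hy
    · exact absurd (hr _ _ hrr) (hno x (hT hx))
    · exact ⟨x, hx, y, hy, hxy, hrr⟩

theorem star {r : V → V → Prop} (hr : ∀ x y, r x y → r y x) (d : ℕ) (hd : 0 < d) :
    ∀ (m : ℕ) (S : Finset V), Ind r m S → m * d ≤ S.card →
      ∃ h, ∃ N ⊆ S, d ≤ N.card ∧ ∀ x ∈ N, r h x ∧ h ≠ x := by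
  classical
  intro m
  induction m with
  | zero =>
    intro S h _
    obtain ⟨u, hu, -⟩ := h ∅ (by simp) (by simp)
    simp at hu
  | succ m ih =>
    intro S h hS
    rw [Nat.succ_mul] at hS
    obtain ⟨v, hv⟩ : S.Nonempty := by rw [← card_pos]; omega
    by_cases hN : d ≤ (S.filter (fun x => r v x ∧ v ≠ x)).card
    · exact ⟨v, _, filter_subset _ _, hN, fun x hx => (mem_filter.1 hx).2⟩
    · have hc := le_card_sdiff (insert v (S.filter (fun x => r v x ∧ v ≠ x))) S
      have hc2 := card_insert_le v (S.filter (fun x => r v x ∧ v ≠ x))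
      obtain ⟨h', N, hNS, rest⟩ := ih (S \ insert v (S.filter (fun x => r v x ∧ v ≠ x)))
        (h.step hr v hv sdiff_subset (by simp) (by
          intro x hx hvx
          rw [mem_sdiff, mem_insert, mem_filter] at hx
          apply hx.2
          by_cases hxv : x = v
          · exact Or.inl hxv
          · exact Or.inr ⟨hx.1, hvx, fun hh => hxv hh.symm⟩)) (by omega)
      exact ⟨h', N, hNS.trans sdiff_subset, rest⟩

theorem rpath {r : V → V → Prop} (hr : ∀ x y, r x y → r y x) (k : ℕ) :
    ∀ (m : ℕ) (S : Finset V), Ind r m S → m * k ≤ S.card →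
      ∃ l : List V, l.Nodup ∧ l.length = k ∧ (∀ x ∈ l, x ∈ S) ∧ l.IsChain r := by
  intro m
  induction m with
  | zero =>
    intro S h _
    obtain ⟨u, hu, -⟩ := h ∅ (by simp) (by simp)
    simp at hu
  | succ m ih =>
    intro S h hS
    rw [Nat.succ_mul] at hS
    by_contra hcon
    have hj : ∃ j < k, (∃ l : List V, l.Nodup ∧ l.length = j ∧ (∀ x ∈ l, x ∈ S) ∧ l.IsChain r) ∧
        ¬ (∃ l : List V, l.Nodup ∧ l.length = j + 1 ∧ (∀ x ∈ l, x ∈ S) ∧ l.IsChain r) := by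
      by_contra hno
      push Not at hno
      have : ∀ j ≤ k, ∃ l : List V, l.Nodup ∧ l.length = j ∧ (∀ x ∈ l, x ∈ S) ∧ l.IsChain r := by
        intro j
        induction j with
        | zero => intro _; exact ⟨[], by simp⟩
        | succ j ih2 =>
          intro hjk
          exact hno j (by omega) (ih2 (by omega))
      exact hcon (this k le_rfl)
    obtain ⟨j, hjk, ⟨l, h1, h2, h3, h4⟩, hno⟩ := hj
    rcases l with _ | ⟨v, p⟩
    · simp at h2
      obtain ⟨v, hv⟩ : S.Nonempty := by rw [← card_pos]; omega
      exact hno ⟨[v], by simp [← h2, hv]⟩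
    · have hc := le_card_sdiff (v :: p).toFinset S
      have hc2 := List.toFinset_card_le (v :: p)
      obtain ⟨l', g1, g2, g3, g4⟩ := ih (S \ (v :: p).toFinset)
        (h.step hr v (h3 v (by simp)) sdiff_subset (by simp) (by
          intro x hx hvx
          rw [mem_sdiff, List.mem_toFinset] at hx
          apply hno
          refine ⟨x :: v :: p, List.nodup_cons.2 ⟨hx.2, h1⟩, by simp [← h2], ?_, ?_⟩
          · intro z hz
            rw [List.mem_cons] at hz
            rcases hz with rfl | hz
            · exact hx.1
            · exact h3 z hz
          · exact List.isChain_cons_cons.2 ⟨hr _ _ hvx, h4⟩)) (by omega)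
      exact hcon ⟨l', g1, g2, fun x hx => (mem_sdiff.1 (g3 x hx)).1, g4⟩

theorem edg_length (a : V) (l : List V) : (edg (a :: l)).length = l.length := by
  induction l generalizing a with
  | nil => simp [edg]
  | cons b l ih => simp [edg, ih]

theorem edg_nodup (l : List V) (h : l.Nodup) : (edg l).Nodup := by
  induction l with
  | nil => simp [edg]
  | cons a l ih =>
    cases l with
    | nil => simp [edg]
    | cons b l =>
      rw [List.nodup_cons] at h
      simp only [edg, List.nodup_cons]
      refine ⟨?_, ih h.2⟩
      intro hh
      exact h.1 (mem_of_mem_edg _ _ hh a (by simp))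

theorem chain_edg {r : V → V → Prop} (hr : ∀ x y, r x y → r y x) (l : List V)
    (h : l.IsChain r) (x y : V) (hxy : s(x, y) ∈ edg l) : r x y := by
  induction l with
  | nil => simp [edg] at hxy
  | cons a l ih =>
    cases l with
    | nil => simp [edg] at hxy
    | cons b l =>
      rw [List.isChain_cons_cons] at h
      simp only [edg, List.mem_cons] at hxy
      rcases hxy with hxy | hxy
      · rcases Sym2.eq_iff.1 hxy with ⟨rfl, rfl⟩ | ⟨rfl, rfl⟩
        · exact h.1
        · exact hr _ _ h.1
      · exact ih h.2 hxy

theorem expand_one {a : ℕ} : ∀ (E : List (Sym2 V)) (l : List V), St G l E ∅ →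
    (∀ x y, s(x, y) ∈ E → x ≠ y ∧ a ≤ (cmn G x y).card) → l.length + E.length < a →
    ∃ l', St G l' [] ∅ ∧ l'.length = l.length + E.length := by
  intro E
  induction E with
  | nil => intro l h _ _; exact ⟨l, h, by simp⟩
  | cons e E ih =>
    intro l h hE hl
    induction e with
    | h u v =>
    obtain ⟨huv, hc⟩ := hE u v (by simp)
    obtain ⟨x, hx, hxl⟩ : ∃ x ∈ cmn G u v, x ∉ l.toFinset := by
      by_contra hno
      push Not at hno
      have := card_le_card (show cmn G u v ⊆ l.toFinset from hno)
      have := List.toFinset_card_le l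
      omega
    rw [mem_cmn] at hx
    obtain ⟨l', h1, h2, -⟩ := h.expand (p := [x]) (R' := ∅) huv (by simp) (by simp)
      (by simpa using hxl) (by
        intro e he
        simp [edg] at he
        rcases he with rfl | rfl
        · exact hx.1
        · exact hx.2.symm) (by simp) (by simp)
    simp only [List.length_cons, List.length_nil] at h2 hl
    obtain ⟨l2, h3, h4⟩ := ih l' h1 (fun x y hxy => hE x y (by simp [hxy])) (by omega)
    exact ⟨l2, h3, by simp; omega⟩

theorem smallCycle {m a k : ℕ} (H : Hyp G m a) (hm : 0 < m) (hk : 2 ≤ k) (ha : 2 * k < a)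
    (hn : m * (m * k) ≤ Fintype.card V) : HasCycleLen G (2 * k) := by
  rcases Nat.eq_or_lt_of_le hk with rfl | hk3
  · obtain ⟨u, -, v, -, huv, hc⟩ := H univ (by rw [card_univ]; nlinarith)
    obtain ⟨x, hx, y, hy, hxy⟩ := one_lt_card.1 (show 1 < (cmn G u v).card by omega)
    rw [mem_cmn] at hx hy
    have : St G [u, x, v, y] [] ∅ := by
      refine ⟨?_, by simp, by simp, ?_, ⟨2, rfl⟩, by simp, by simp⟩
      · have := hx.1.ne
        have := hx.2.ne
        have := hy.1.ne
        have := hy.2.ne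
        simp; tauto
      · intro e he
        right
        simp [CE, edg] at he
        rcases he with rfl | rfl | rfl | rfl
        · exact hx.1
        · exact hx.2.symm
        · exact hy.2
        · exact hy.1.symm
    exact this.toCycle
  · set r : V → V → Prop := fun u v => u ≠ v ∧ a ≤ (cmn G u v).card with hrdef
    have hr : ∀ x y, r x y → r y x := fun x y h => ⟨h.1.symm, by rw [cmn_comm]; exact h.2⟩
    have hI : ∀ S, Ind r m S := by
      intro S T _ hT
      obtain ⟨u, hu, v, hv, huv, hc⟩ := H T hT
      exact ⟨u, hu, v, hv, huv, huv, hc⟩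
    obtain ⟨h, N, -, hNc, hN⟩ := star hr (m * k) (Nat.mul_pos hm (by omega)) m univ (hI _)
      (by rw [card_univ]; exact hn)
    obtain ⟨p, p1, p2, p3, p4⟩ := rpath hr (k - 1) m N (hI _)
      (le_trans (Nat.mul_le_mul_left _ (by omega)) hNc)
    rcases List.eq_nil_or_concat p with rfl | ⟨mid, u, rfl⟩
    · simp at p2; omega
    simp only [List.concat_eq_append] at p1 p2 p3 p4
    have hnd : (h :: (mid ++ [u])).Nodup := by
      rw [List.nodup_cons]
      exact ⟨fun hh => (hN h (p3 h hh)).2 rfl, p1⟩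
    have hu := hN u (p3 u (by simp))
    have hch : (h :: (mid ++ [u])).IsChain r := by
      rw [List.isChain_cons]
      refine ⟨?_, p4⟩
      intro y hy
      exact (hN y (p3 y (List.mem_of_mem_head? hy))).1
    have hlen : (mid ++ [u]).length = k - 1 := p2
    have hml : mid.length + 1 = k - 1 := by simpa using hlen
    have hCE : CE (h :: (mid ++ [u])) = edg (h :: (mid ++ [u])) ++ [s(u, h)] := by
      rw [CE_cons]
      have h1 : h :: (mid ++ [u] ++ [h]) = (h :: mid) ++ u :: [h] := by simp
      rw [h1, edg_append]
      simp [edg]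
    have hCEl : (CE (h :: (mid ++ [u]))).length = k := by
      rw [hCE, List.length_append, edg_length, hlen]; simp; omega
    have hst : St G (h :: (mid ++ [u])) (CE (h :: (mid ++ [u]))) ∅ := by
      refine ⟨hnd, ?_, fun e he => he, fun e he => Or.inl he, ?_, by simp, ?_⟩
      · rw [hCE, List.nodup_append]
        refine ⟨edg_nodup _ hnd, by simp, ?_⟩
        rintro e he f hf rfl
        rw [List.mem_singleton] at hf
        subst hf
        exact not_mem_inner mid u h hu.2.symm hnd (by omega) he
      · rw [hCEl, List.length_cons, hlen]
        exact ⟨k, by omega⟩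
      · rw [List.length_cons, hlen]; omega
    obtain ⟨l', g1, g2⟩ := expand_one (a := a) _ _ hst (by
      intro x y hxy
      rw [mem_CE_form] at hxy
      rcases hxy with hxy | hxy
      · exact chain_edg hr _ hch x y hxy
      · rcases Sym2.eq_iff.1 hxy with ⟨rfl, rfl⟩ | ⟨rfl, rfl⟩
        · exact hr _ _ hu.1
        · exact hu.1) (by rw [hCEl, List.length_cons, hlen]; omega)
    have := g1.toCycle
    rw [g2, hCEl, List.length_cons, hlen] at this
    convert this using 1
    omega

end small
end EC
set_option linter.unusedSectionVars false
namespace EC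
section num
open Finset
variable {V : Type*} [Fintype V] [DecidableEq V] {G : SimpleGraph V}

theorem hyp_of [DecidableRel G.Adj] (c : ℝ) (hc0 : 0 < c) (hn0 : 0 < Fintype.card V)
    (hδ : ∀ u, c * (Fintype.card V : ℝ) ≤ (G.degree u : ℝ)) (m a : ℕ)
    (hm2 : 2 ≤ m * c) (hm : ((m : ℝ) - 1) * c ≤ 2) (hm1 : 0 < m)
    (ha : ∀ k : ℕ, k < a → (k : ℝ) ≤ c ^ 2 * Fintype.card V / 4) : Hyp G m a := by
  intro T' hT'
  obtain ⟨T, hTT, hTc⟩ := exists_subset_card_eq hT'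
  by_contra hcon
  have hlow : ∀ u ∈ T, ∀ v ∈ T, u ≠ v →
      ((cmn G u v).card : ℝ) ≤ c ^ 2 * Fintype.card V / 4 := by
    intro u hu v hv huv
    apply ha
    by_contra h
    exact hcon ⟨u, hTT hu, v, hTT hv, huv, by omega⟩
  set n : ℝ := ((Fintype.card V : ℕ) : ℝ) with hn
  have hnpos : 0 < n := by rw [hn]; exact_mod_cast hn0
  let e : V → V → ℝ := fun u z => if G.Adj u z then 1 else 0
  have hdeg : ∀ u, ∑ z, e u z = (G.degree u : ℝ) := by
    intro u
    simp only [e]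
    rw [Finset.sum_boole, ← SimpleGraph.card_neighborFinset_eq_degree,
      SimpleGraph.neighborFinset_eq_filter]
  have hcod : ∀ u v, ∑ z, e u z * e v z = ((cmn G u v).card : ℝ) := by
    intro u v
    have : cmn G u v = univ.filter (fun z => G.Adj u z ∧ G.Adj v z) := by
      ext z; simp [mem_cmn]
    rw [this, ← Finset.sum_boole]
    apply sum_congr rfl
    intro z _
    simp only [e]
    by_cases h1 : G.Adj u z <;> by_cases h2 : G.Adj v z <;> simp [h1, h2]
  have hpt : ∀ z, 3 * (∑ u ∈ T, e u z) - 2 ≤ (∑ u ∈ T, e u z) * (∑ u ∈ T, e u z) := by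
    intro z
    have : ∑ u ∈ T, e u z = ((T.filter (fun u => G.Adj u z)).card : ℝ) := by
      simp only [e]; rw [Finset.sum_boole]
    rw [this]
    generalize (T.filter (fun u => G.Adj u z)).card = k
    rcases k with _ | _ | k
    · norm_num
    · norm_num
    · push_cast
      have : (0 : ℝ) ≤ k := Nat.cast_nonneg k
      nlinarith
  have hsum := sum_le_sum (fun z (_ : z ∈ (univ : Finset V)) => hpt z)
  rw [sum_sub_distrib, ← mul_sum, sum_comm] at hsum
  have hR : ∑ z, (∑ u ∈ T, e u z) * (∑ u ∈ T, e u z)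
      = ∑ u ∈ T, ∑ v ∈ T, ((cmn G u v).card : ℝ) := by
    simp_rw [sum_mul_sum, ← hcod]
    rw [sum_comm]
    apply sum_congr rfl
    intro u _
    rw [sum_comm]
  rw [hR] at hsum
  have hdiag : ∀ u ∈ T, ∑ v ∈ T, ((cmn G u v).card : ℝ)
      ≤ (G.degree u : ℝ) + ((m : ℝ) - 1) * (c ^ 2 * n / 4) := by
    intro u hu
    rw [← add_sum_erase T _ hu]
    have h1 : ((cmn G u u).card : ℝ) = G.degree u := by
      rw [← hcod, ← hdeg]
      apply sum_congr rfl
      intro z _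
      simp only [e]; split_ifs <;> simp
    rw [h1]
    have h2 := sum_le_card_nsmul (T.erase u) (fun v => ((cmn G u v).card : ℝ)) (c ^ 2 * n / 4)
      (fun v hv => hlow u hu v (mem_of_mem_erase hv) (ne_of_mem_erase hv).symm)
    rw [card_erase_of_mem hu, hTc, nsmul_eq_mul, Nat.cast_sub (by omega)] at h2
    push_cast at h2
    linarith
  have hd := sum_le_sum hdiag
  rw [sum_add_distrib, sum_const, hTc, nsmul_eq_mul] at hd
  have hdd : ∑ u ∈ T, ∑ z, e u z = ∑ u ∈ T, (G.degree u : ℝ) := sum_congr rfl (fun u _ => hdeg u)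
  rw [hdd] at hsum
  have hlo : (m : ℝ) * (c * n) ≤ ∑ u ∈ T, (G.degree u : ℝ) := by
    have := card_nsmul_le_sum T (fun u => (G.degree u : ℝ)) (c * n) (fun u _ => hδ u)
    rwa [hTc, nsmul_eq_mul] at this
  have hconst : ∑ _z : V, (2 : ℝ) = 2 * n := by
    rw [sum_const, nsmul_eq_mul, card_univ, mul_comm]
  rw [hconst] at hsum
  have hmm : (m : ℝ) * (((m : ℝ) - 1) * (c ^ 2 * n / 4)) ≤ (m * c) * n / 2 := by
    have h0 : (0 : ℝ) ≤ m * c * n := by positivity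
    nlinarith [mul_le_mul_of_nonneg_left hm h0]
  have h5 : 2 * n ≤ (m * c) * n := mul_le_mul_of_nonneg_right hm2 hnpos.le
  nlinarith

theorem arith (c : ℝ) (hc0 : 0 < c) (hc1 : c ≤ 1) (n m D De M : ℕ)
    (hn : 18 * (750000 / c ^ 5) / c ^ 2 ≤ (n : ℝ))
    (hm : m = ⌈2 / c⌉₊) (hDe : De = ⌈16 / c ^ 2⌉₊) (hD : D = ⌈64 / c ^ 3⌉₊)
    (hM : M = 2 * m + De) :
    0 < m ∧ 0 < D ∧ 0 < De ∧ 0 < n ∧ 2 ≤ m * c ∧ ((m : ℝ) - 1) * c ≤ 2 ∧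
    (3 * M + 3) + 2 * (M + 3) * De + 2 * (n / De + 1) < ⌈c ^ 2 * n / 4⌉₊ ∧
    (3 * M + 3) + m + (2 * (M + 3) + m) * D + (2 * m - 2) * (2 * (n / D + 1))
      < ⌈c ^ 2 * n / 4⌉₊ ∧
    ((((2 * (M + 3) + 1) * (4 * m) + 4 * m + 3 * D + 3 * De + 3 +
      M * (4 * m + 3 * D + 3 * De) : ℕ)) : ℝ) ≤ 750000 / c ^ 5 ∧
    (∀ t, t < (2 * M + 1) * (4 * m) + 4 * m + De + 3 + M →
      t < ⌈c ^ 2 * n / 4⌉₊ ∧ m * (m * t) ≤ n) := by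
  obtain ⟨x, hx⟩ : ∃ x, x = 1 / c := ⟨_, rfl⟩
  have hx1 : 1 ≤ x := by rw [hx, le_div_iff₀ hc0]; linarith
  have hxc : x * c = 1 := by rw [hx]; field_simp
  have hx0 : 0 < x := by linarith
  have e1 : 2 / c = 2 * x := by rw [hx]; ring
  have e2 : 16 / c ^ 2 = 16 * x ^ 2 := by rw [hx]; field_simp
  have e3 : 64 / c ^ 3 = 64 * x ^ 3 := by rw [hx]; field_simp
  have e5 : 750000 / c ^ 5 = 750000 * x ^ 5 := by rw [hx]; field_simp
  have x12 : x ≤ x ^ 2 := by nlinarith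
  have x23 : x ^ 2 ≤ x ^ 3 := pow_le_pow_right₀ hx1 (by norm_num)
  have x34 : x ^ 3 ≤ x ^ 4 := pow_le_pow_right₀ hx1 (by norm_num)
  have x45 : x ^ 4 ≤ x ^ 5 := pow_le_pow_right₀ hx1 (by norm_num)
  have m1 : 2 * x ≤ m := by rw [hm, e1]; exact Nat.le_ceil _
  have m2 : (m : ℝ) ≤ 2 * x + 1 := by
    rw [hm, e1]; exact (Nat.ceil_lt_add_one (by positivity)).le
  have De1 : 16 * x ^ 2 ≤ De := by rw [hDe, e2]; exact Nat.le_ceil _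
  have De2 : (De : ℝ) ≤ 16 * x ^ 2 + 1 := by
    rw [hDe, e2]; exact (Nat.ceil_lt_add_one (by positivity)).le
  have D1 : 64 * x ^ 3 ≤ D := by rw [hD, e3]; exact Nat.le_ceil _
  have D2 : (D : ℝ) ≤ 64 * x ^ 3 + 1 := by
    rw [hD, e3]; exact (Nat.ceil_lt_add_one (by positivity)).le
  have MR : (M : ℝ) = 2 * m + De := by rw [hM]; push_cast; ring
  have m3 : (m : ℝ) ≤ 3 * x := by linarith
  have De3 : (De : ℝ) ≤ 17 * x ^ 2 := by linarith
  have D3 : (D : ℝ) ≤ 65 * x ^ 3 := by linarith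
  have M3 : (M : ℝ) ≤ 23 * x ^ 2 := by linarith
  have m0 : (0 : ℝ) < m := by linarith
  have De0 : (0 : ℝ) < De := by linarith
  have D0 : (0 : ℝ) < D := by linarith
  have M0 : (0 : ℝ) ≤ M := Nat.cast_nonneg _
  obtain ⟨N, hN⟩ : ∃ N, N = c ^ 2 * n := ⟨_, rfl⟩
  have nN : (n : ℝ) = N * x ^ 2 := by
    rw [hN]
    have : c ^ 2 * n * x ^ 2 = (x * c) ^ 2 * n := by ring
    rw [this, hxc]; ring
  have hNx : 13500000 * x ^ 5 ≤ N := by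
    rw [div_le_iff₀ (by positivity), e5] at hn
    rw [hN]; linarith
  have hx5 : 0 < x ^ 5 := by positivity
  have hN0 : 0 < N := by linarith
  have hn0 : (0 : ℝ) < n := by rw [nN]; positivity
  have ca : N / 4 ≤ (⌈c ^ 2 * n / 4⌉₊ : ℝ) := by rw [hN]; exact Nat.le_ceil _
  have q1 : ((n / De : ℕ) : ℝ) ≤ N / 16 := by
    refine Nat.cast_div_le.trans ?_
    rw [div_le_iff₀ De0, nN]
    have := mul_le_mul_of_nonneg_left De1 hN0.le
    linarith
  have q2 : ((n / D : ℕ) : ℝ) * x ≤ N / 64 := by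
    have h : ((n / D : ℕ) : ℝ) * D ≤ n := by
      have := (Nat.cast_div_le (m := n) (n := D) (α := ℝ))
      rwa [le_div_iff₀ D0] at this
    have h0 : (0 : ℝ) ≤ ((n / D : ℕ) : ℝ) := Nat.cast_nonneg _
    have h1 : ((n / D : ℕ) : ℝ) * (64 * x ^ 3) ≤ N * x ^ 2 := by
      rw [← nN]; exact (mul_le_mul_of_nonneg_left D1 h0).trans h
    have hx2 : 0 < x ^ 2 := by positivity
    have h2 : (((n / D : ℕ) : ℝ) * x * 64) * x ^ 2 ≤ N * x ^ 2 := by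
      calc _ = ((n / D : ℕ) : ℝ) * (64 * x ^ 3) := by ring
        _ ≤ _ := h1
    have := le_of_mul_le_mul_right h2 hx2
    linarith
  have p1 : (M : ℝ) * De ≤ 23 * x ^ 2 * (17 * x ^ 2) := by gcongr
  have p2 : (M : ℝ) * D ≤ 23 * x ^ 2 * (65 * x ^ 3) := by gcongr
  have p3 : (m : ℝ) * D ≤ 3 * x * (65 * x ^ 3) := by gcongr
  have p4 : (M : ℝ) * m ≤ 23 * x ^ 2 * (3 * x) := by gcongr
  ring_nf at p1 p2 p3 p4
  refine ⟨by exact_mod_cast m0, by exact_mod_cast D0, by exact_mod_cast De0,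
    by exact_mod_cast hn0, ?_, ?_, ?_, ?_, ?_, ?_⟩
  · have := mul_le_mul_of_nonneg_right m1 hc0.le
    linarith
  · have := mul_le_mul_of_nonneg_right m2 hc0.le
    linarith
  · have : (((3 * M + 3) + 2 * (M + 3) * De + 2 * (n / De + 1) : ℕ) : ℝ)
        < (⌈c ^ 2 * n / 4⌉₊ : ℝ) := by
      refine lt_of_lt_of_le ?_ ca
      push_cast
      linarith
    exact_mod_cast this
  · have hm1 : 1 ≤ m := by exact_mod_cast m0
    have : (((3 * M + 3) + m + (2 * (M + 3) + m) * D + (2 * m - 2) * (2 * (n / D + 1)) : ℕ) : ℝ)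
        < (⌈c ^ 2 * n / 4⌉₊ : ℝ) := by
      refine lt_of_lt_of_le ?_ ca
      rw [Nat.cast_add, Nat.cast_mul (2 * m - 2), Nat.cast_sub (by omega)]
      have h1 : (((2 * m : ℕ) : ℝ) - ((2 : ℕ) : ℝ)) * ((2 * (n / D + 1) : ℕ) : ℝ)
          ≤ 4 * x * (2 * (((n / D : ℕ) : ℝ) + 1)) := by
        have : ((2 * m : ℕ) : ℝ) - ((2 : ℕ) : ℝ) ≤ 4 * x := by push_cast; linarith
        have h3 : ((2 * (n / D + 1) : ℕ) : ℝ) = 2 * (((n / D : ℕ) : ℝ) + 1) := by push_cast; ring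
        rw [h3]
        exact mul_le_mul_of_nonneg_right this (by positivity)
      have h2 : (((3 * M + 3) + m + (2 * (M + 3) + m) * D : ℕ) : ℝ) ≤ 5000 * x ^ 5 := by
        push_cast
        linarith
      linarith
    exact_mod_cast this
  · rw [e5]; push_cast
    linarith
  · intro t ht
    have ht2 : (t : ℝ) ≤ 700 * x ^ 3 := by
      have : (t : ℝ) ≤ (((2 * M + 1) * (4 * m) + 4 * m + De + 3 + M : ℕ) : ℝ) := by
        exact_mod_cast ht.le
      refine this.trans ?_
      push_cast
      linarith
    constructor
    · have : (t : ℝ) < (⌈c ^ 2 * n / 4⌉₊ : ℝ) := by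
        refine lt_of_lt_of_le ?_ ca
        linarith
      exact_mod_cast this
    · have : ((m * (m * t) : ℕ) : ℝ) ≤ n := by
        push_cast
        have h1 : (m : ℝ) * (m * t) ≤ 3 * x * (3 * x * (700 * x ^ 3)) := by gcongr
        have h2 : N ≤ n := by
          rw [nN]
          have := mul_le_mul_of_nonneg_left (hx1.trans x12) hN0.le
          linarith
        have h3 : 3 * x * (3 * x * (700 * x ^ 3)) = 6300 * x ^ 5 := by ring
        have h5 : 0 < x ^ 5 := by positivity
        linarith
      exact_mod_cast this

end num
end EC

/-- For every even `t` with `4 ≤ t ≤ ec(G) - K`, where `ec(G)` is the length of a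
longest even cycle of `G`, the graph `G` contains a cycle of length `t`.  The
condition `t ≤ ec(G) - K` is expressed by the existence of an even cycle of
length `L` with `t ≤ L - K`; in particular the claim is vacuous when `G` has no
even cycle. -/
theorem stmt19 (c : ℝ) (hc0 : 0 < c) (hc1 : c ≤ 1)
    (V : Type*) [Fintype V] (G : SimpleGraph V) [DecidableRel G.Adj]
    (hn : 18 * (750000 / c ^ 5) / c ^ 2 ≤ (Fintype.card V : ℝ))
    (hδ : c * (Fintype.card V : ℝ) ≤ (G.minDegree : ℝ)) :
    ∀ t : ℕ, Even t → 4 ≤ t →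
      (∃ (v : V) (w : G.Walk v v), w.IsCycle ∧ Even w.length ∧
        (t : ℝ) ≤ (w.length : ℝ) - 750000 / c ^ 5) →
      HasCycleLen G t := by
  classical
  rintro t ht ht4 ⟨v, w, hw, hwe, hwt⟩
  obtain ⟨hm0, hD0, hDe0, hn0, k1, k2, k3, k4, k5, k6⟩ :=
    EC.arith c hc0 hc1 (Fintype.card V) _ _ _ _ hn rfl rfl rfl rfl
  have H := EC.hyp_of (G := G) c hc0 hn0
    (fun u => hδ.trans (by exact_mod_cast G.minDegree_le_degree u)) _
    ⌈c ^ 2 * (Fintype.card V : ℝ) / 4⌉₊ k1 k2 hm0 (fun k hk => (Nat.lt_ceil.1 hk).le)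
  by_cases hT : (2 * (2 * ⌈2 / c⌉₊ + ⌈16 / c ^ 2⌉₊) + 1) * (4 * ⌈2 / c⌉₊) + 4 * ⌈2 / c⌉₊
      + ⌈16 / c ^ 2⌉₊ + 3 + (2 * ⌈2 / c⌉₊ + ⌈16 / c ^ 2⌉₊) ≤ t
  · obtain ⟨l, hl, hll⟩ := EC.St.ofCycle w hw hwe
    refine EC.large hl H hm0 hD0 hDe0 k3 k4 ?_ ht (by omega) hT
    rw [hll]
    have h9 := (add_le_add_left k5 (t : ℝ)).trans (show _ ≤ (w.length : ℝ) by linarith)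
    exact_mod_cast h9
  · obtain ⟨a1, a2⟩ := k6 t (by omega)
    obtain ⟨k, hk⟩ := ht
    obtain rfl : t = 2 * k := by omega
    refine EC.smallCycle H hm0 (by omega) a1 (le_trans ?_ a2)
    exact Nat.mul_le_mul_left _ (Nat.mul_le_mul_left _ (by omega))
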